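/- arXiv:2102.04393 — 5 statements merged into one kernel-verified Lean document; each statement's English description precedes it below -/
import Mathlib

section
/- Let q ≥ 1. The set 𝒞_q of stabilizing controllers of order q is an open subset of the space ℝ^{q×q} × ℝ^{q×p} × ℝ^{m×q} of controller parameters (with its standard topology). -/
open Matrix

noncomputable section

/-- A real square matrix is stable (Hurwitz): every eigenvalue of the matrix,
regarded as a complex matrix, has negative real part. -/
def IsStableMatrix {k : Type*} [Fintype k] [DecidableEq k] (M : Matrix k k ℝ) : Prop :=
  ∀ μ ∈ spectrum ℂ (M.map (algebraMap ℝ ℂ)), μ.re < 0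

open scoped Matrix.Norms.Operator in
theorem isOpen_spectrum_re_neg (k : Type*) [Fintype k] [DecidableEq k] :
    IsOpen {M : Matrix k k ℂ | ∀ μ ∈ spectrum ℂ M, μ.re < 0} :=
  upperHemicontinuous_iff_isOpen_preimage_Iic.1 (upperHemicontinuous_spectrum ℂ (Matrix k k ℂ)) {z : ℂ | z.re < 0}
    (isOpen_lt Complex.continuous_re continuous_const)

/-- For `q ≥ 1`, the set `𝒞_q` of stabilizing controllers of order `q`
is an open subset of `ℝ^{q×q} × ℝ^{q×p} × ℝ^{m×q}`. -/
theorem Cq_isOpen (n m p q : ℕ) (hn : 0 < n) (hm : 0 < m) (hp : 0 < p) (hq : 1 ≤ q)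
    (A : Matrix (Fin n) (Fin n) ℝ) (B : Matrix (Fin n) (Fin m) ℝ)
    (C : Matrix (Fin p) (Fin n) ℝ) :
    IsOpen {K : Matrix (Fin q) (Fin q) ℝ × Matrix (Fin q) (Fin p) ℝ × Matrix (Fin m) (Fin q) ℝ |
      IsStableMatrix (fromBlocks A (B * K.2.2) (K.2.1 * C) K.1)} := by
  have key : Continuous (fun K : Matrix (Fin q) (Fin q) ℝ × Matrix (Fin q) (Fin p) ℝ ×
      Matrix (Fin m) (Fin q) ℝ =>
      (fromBlocks A (B * K.2.2) (K.2.1 * C) K.1).map (algebraMap ℝ ℂ)) := by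
    refine Continuous.matrix_map ?_ (by simpa using Complex.continuous_ofReal)
    exact Continuous.matrix_fromBlocks (by fun_prop) (by fun_prop) (by fun_prop) (by fun_prop)
  exact (isOpen_spectrum_re_neg (Fin n ⊕ Fin q)).preimage key
end
end

section
/- Let q ≥ 1 and suppose 𝒞_q is nonempty. There exists a function J : ℝ^{q×q} × ℝ^{q×p} × ℝ^{m×q} → ℝ that is real-analytic on the open set 𝒞_q and such that for every K ∈ 𝒞_q and every symmetric (n+q)×(n+q) matrix X with A_cl(K)·X + X·A_cl(K)ᵀ + M_W(K) = 0, one has J(K) = tr(M_Q(K)·X). (The LQG cost is a real-analytic function on 𝒞_q.) -/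
open Matrix

noncomputable section

attribute [local instance] Matrix.normedAddCommGroup Matrix.normedSpace

/-- The closed-loop matrix of the plant `(A, B, C)` with a dynamic controller
`K = (A_K, B_K, C_K)` of order `q`. -/
def Acl {n m p q : ℕ} (A : Matrix (Fin n) (Fin n) ℝ) (B : Matrix (Fin n) (Fin m) ℝ)
    (C : Matrix (Fin p) (Fin n) ℝ)
    (K : Matrix (Fin q) (Fin q) ℝ × Matrix (Fin q) (Fin p) ℝ × Matrix (Fin m) (Fin q) ℝ) :
    Matrix (Fin n ⊕ Fin q) (Fin n ⊕ Fin q) ℝ :=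
  fromBlocks A (B * K.2.2) (K.2.1 * C) K.1

/-- `M_W(K) = diag(W, B_K V B_Kᵀ)`. -/
def MW {n m p q : ℕ} (W : Matrix (Fin n) (Fin n) ℝ) (V : Matrix (Fin p) (Fin p) ℝ)
    (K : Matrix (Fin q) (Fin q) ℝ × Matrix (Fin q) (Fin p) ℝ × Matrix (Fin m) (Fin q) ℝ) :
    Matrix (Fin n ⊕ Fin q) (Fin n ⊕ Fin q) ℝ :=
  fromBlocks W 0 0 (K.2.1 * V * (K.2.1)ᵀ)

/-- `M_Q(K) = diag(Q, C_Kᵀ R C_K)`. -/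
def MQ {n m p q : ℕ} (Q : Matrix (Fin n) (Fin n) ℝ) (R : Matrix (Fin m) (Fin m) ℝ)
    (K : Matrix (Fin q) (Fin q) ℝ × Matrix (Fin q) (Fin p) ℝ × Matrix (Fin m) (Fin q) ℝ) :
    Matrix (Fin n ⊕ Fin q) (Fin n ⊕ Fin q) ℝ :=
  fromBlocks Q 0 0 ((K.2.2)ᵀ * R * K.2.2)

theorem lyap_ker_C {k : Type*} [Fintype k] [DecidableEq k] (M X : Matrix k k ℂ)
    (hM : ∀ μ ∈ spectrum ℂ M, μ.re < 0) (h : M * X + X * Mᵀ = 0) : X = 0 := by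
  have hs : M * X = X * (-Mᵀ) := by rw [mul_neg]; exact eq_neg_of_add_eq_zero_left h
  have hpoly : ∀ f : Polynomial ℂ, Polynomial.aeval M f * X = X * Polynomial.aeval (-Mᵀ) f := by
    intro f
    induction f using Polynomial.induction_on' with
    | add f g hf hg => simp [add_mul, mul_add, hf, hg]
    | monomial j a =>
      have hj : M ^ j * X = X * (-Mᵀ) ^ j := by
        induction j with
        | zero => simp
        | succ j ih => rw [pow_succ, mul_assoc, hs, ← mul_assoc, ih, mul_assoc, ← pow_succ]
      simp only [Polynomial.aeval_monomial, ← Algebra.smul_def, smul_mul_assoc, mul_smul_comm, hj]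
  have h0 := hpoly (-Mᵀ).charpoly
  rw [Matrix.aeval_self_charpoly, mul_zero] at h0
  have hu : IsUnit (Polynomial.aeval M (-Mᵀ).charpoly) := by
    by_contra hu
    have hz : (0 : ℂ) ∈ spectrum ℂ (Polynomial.aeval M (-Mᵀ).charpoly) := by
      rwa [spectrum.zero_mem_iff]
    have hnt : Nontrivial (Matrix k k ℂ) := by
      by_contra hnt
      rw [not_nontrivial_iff_subsingleton] at hnt
      exact hu (isUnit_of_subsingleton _)
    rw [spectrum.map_polynomial_aeval_of_degree_pos] at hz
    · obtain ⟨μ, hμ, hr⟩ := hz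
      have h1 : μ ∈ spectrum ℂ (-Mᵀ) := Matrix.mem_spectrum_of_isRoot_charpoly hr
      have h2 : -μ ∈ spectrum ℂ Mᵀ := by
        rw [← spectrum.neg_eq] at h1; simpa using h1
      have h3 : -μ ∈ spectrum ℂ M := by
        rw [Matrix.mem_spectrum_iff_isRoot_charpoly] at h2 ⊢
        rwa [Matrix.charpoly_transpose] at h2
      have := hM _ hμ
      have := hM _ h3
      simp at this; linarith
    · rw [Matrix.charpoly_degree_eq_dim]
      have hk : Nonempty k := by
        by_contra hk
        rw [not_nonempty_iff] at hk
        exact not_subsingleton (Matrix k k ℂ) inferInstance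
      exact_mod_cast Fintype.card_pos
  exact (hu.mul_right_eq_zero).1 h0

theorem lyap_ker {k : Type*} [Fintype k] [DecidableEq k] (M X : Matrix k k ℝ)
    (hM : IsStableMatrix M) (h : M * X + X * Mᵀ = 0) : X = 0 := by
  have := lyap_ker_C (M.map (algebraMap ℝ ℂ)) (X.map (algebraMap ℝ ℂ)) hM (by
    rw [← Matrix.transpose_map, ← Matrix.map_mul, ← Matrix.map_mul, ← Matrix.map_add _ (map_add _), h]
    simp)
  ext i j
  have h1 := congrFun (congrFun this i) j
  simpa using h1

/-- Analyticity of the solution of a linear equation depending linearly on a parameter. -/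
theorem exists_analytic_solver {E F : Type*} [NormedAddCommGroup E] [NormedSpace ℝ E]
    [FiniteDimensional ℝ E] [NormedAddCommGroup F] [NormedSpace ℝ F] [FiniteDimensional ℝ F]
    (T : E →ₗ[ℝ] F →ₗ[ℝ] F) :
    ∃ S : E → F → F, (∀ a, Function.Injective (T a) → ∀ b, S a (T a b) = b) ∧
      ∀ {G : Type _} [NormedAddCommGroup G] [NormedSpace ℝ G] (f : G → E) (g : G → F) (x : G),
        AnalyticAt ℝ f x → AnalyticAt ℝ g x → Function.Injective (T (f x)) →
        AnalyticAt ℝ (fun y => S (f y) (g y)) x := by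
  have : CompleteSpace F := FiniteDimensional.complete ℝ F
  let L : E →L[ℝ] (F →L[ℝ] F) := LinearMap.toContinuousLinearMap
    ((LinearMap.toContinuousLinearMap (𝕜 := ℝ) (E := F) (F' := F)).toLinearMap ∘ₗ T)
  have hL : ∀ a b, L a b = T a b := fun a b => rfl
  have hunit : ∀ a, Function.Injective (T a) → IsUnit (L a) := by
    intro a hinj
    let e := (LinearEquiv.ofInjectiveEndo _ hinj).toContinuousLinearEquiv
    have : L a = (e : F →L[ℝ] F) := by ext X : 1; rfl
    rw [this]
    exact ⟨ContinuousLinearEquiv.toUnit e, rfl⟩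
  refine ⟨fun a b => Ring.inverse (L a) b, ?_, ?_⟩
  · intro a ha b
    have := Ring.inverse_mul_cancel _ (hunit a ha)
    exact DFunLike.congr_fun this b
  · intro G _ _ f g x hf hg hinj
    obtain ⟨u, hu⟩ := hunit _ hinj
    have hLf : AnalyticAt ℝ (fun y => L (f y)) x := (L.analyticAt _).comp hf
    have hI : AnalyticAt ℝ (fun y => Ring.inverse (L (f y))) x := by
      refine AnalyticAt.comp (g := Ring.inverse) ?_ hLf
      rw [← hu]
      exact analyticAt_inverse u
    exact ((ContinuousLinearMap.id ℝ (F →L[ℝ] F)).analyticAt_bilinear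
      (Ring.inverse (L (f x)), g x)).comp₂ hI hg

/-- The Lyapunov operator. -/
def lyapOp (k : Type*) [Fintype k] [DecidableEq k] :
    Matrix k k ℝ →ₗ[ℝ] Matrix k k ℝ →ₗ[ℝ] Matrix k k ℝ :=
  LinearMap.mul ℝ (Matrix k k ℝ) +
    (LinearMap.mul ℝ (Matrix k k ℝ)).flip ∘ₗ (Matrix.transposeLinearEquiv k k ℝ ℝ).toLinearMap

theorem lyapOp_apply {k : Type*} [Fintype k] [DecidableEq k] (M X : Matrix k k ℝ) :
    lyapOp k M X = M * X + X * Mᵀ := by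
  simp [lyapOp]

theorem lyapOp_injective {k : Type*} [Fintype k] [DecidableEq k] (M : Matrix k k ℝ)
    (hM : IsStableMatrix M) : Function.Injective (lyapOp k M) := by
  rw [← LinearMap.ker_eq_bot, LinearMap.ker_eq_bot']
  intro X hX
  exact lyap_ker M X hM (by rw [← lyapOp_apply]; exact hX)

theorem an_mul {E a b c : Type*} [NormedAddCommGroup E] [NormedSpace ℝ E] [Fintype a] [Fintype b] [Fintype c]
    {f : E → Matrix a b ℝ} {g : E → Matrix b c ℝ} {x : E}
    (hf : AnalyticAt ℝ f x) (hg : AnalyticAt ℝ g x) : AnalyticAt ℝ (fun y => f y * g y) x := by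
  refine analyticAt_pi_iff.2 fun i => analyticAt_pi_iff.2 fun j => ?_
  simp only [Matrix.mul_apply]
  refine Finset.analyticAt_fun_sum _ fun l _ => ?_
  exact (analyticAt_pi_iff.1 (analyticAt_pi_iff.1 hf i) l).mul
    (analyticAt_pi_iff.1 (analyticAt_pi_iff.1 hg l) j)

theorem an_tr {E a b : Type*} [NormedAddCommGroup E] [NormedSpace ℝ E] [Fintype a] [Fintype b]
    {f : E → Matrix a b ℝ} {x : E}
    (hf : AnalyticAt ℝ f x) : AnalyticAt ℝ (fun y => (f y)ᵀ) x :=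
  analyticAt_pi_iff.2 fun i => analyticAt_pi_iff.2 fun j => 
    analyticAt_pi_iff.1 (analyticAt_pi_iff.1 hf j) i

theorem an_blocks {E a b c d : Type*} [NormedAddCommGroup E] [NormedSpace ℝ E]
    [Fintype a] [Fintype b] [Fintype c] [Fintype d]
    {f : E → Matrix a c ℝ} {g : E → Matrix a d ℝ} {h : E → Matrix b c ℝ} {k : E → Matrix b d ℝ} {x : E}
    (hf : AnalyticAt ℝ f x) (hg : AnalyticAt ℝ g x) (hh : AnalyticAt ℝ h x) (hk : AnalyticAt ℝ k x) :
    AnalyticAt ℝ (fun y => fromBlocks (f y) (g y) (h y) (k y)) x := by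
  refine analyticAt_pi_iff.2 fun i => analyticAt_pi_iff.2 fun j => ?_
  rcases i with i | i <;> rcases j with j | j
  · exact analyticAt_pi_iff.1 (analyticAt_pi_iff.1 hf i) j
  · exact analyticAt_pi_iff.1 (analyticAt_pi_iff.1 hg i) j
  · exact analyticAt_pi_iff.1 (analyticAt_pi_iff.1 hh i) j
  · exact analyticAt_pi_iff.1 (analyticAt_pi_iff.1 hk i) j

/-- The LQG cost is a real-analytic function on the open set `𝒞_q`:
there is a function `J` on controller space, real-analytic on `𝒞_q`, whose value at any
`K ∈ 𝒞_q` is `tr(M_Q(K)·X)` for any symmetric solution `X` of the Lyapunov equation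
`A_cl(K)·X + X·A_cl(K)ᵀ + M_W(K) = 0`. -/
theorem lqg_cost_real_analytic (n m p q : ℕ)
    (hn : 0 < n) (hm : 0 < m) (hp : 0 < p) (hq : 1 ≤ q)
    (A : Matrix (Fin n) (Fin n) ℝ) (B : Matrix (Fin n) (Fin m) ℝ)
    (C : Matrix (Fin p) (Fin n) ℝ)
    (Q W : Matrix (Fin n) (Fin n) ℝ) (R : Matrix (Fin m) (Fin m) ℝ)
    (V : Matrix (Fin p) (Fin p) ℝ)
    (hQ : Q.PosSemidef) (hW : W.PosSemidef) (hR : R.PosDef) (hV : V.PosDef)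
    (hne : {K : Matrix (Fin q) (Fin q) ℝ × Matrix (Fin q) (Fin p) ℝ × Matrix (Fin m) (Fin q) ℝ |
        IsStableMatrix (Acl A B C K)}.Nonempty) :
    ∃ J : Matrix (Fin q) (Fin q) ℝ × Matrix (Fin q) (Fin p) ℝ × Matrix (Fin m) (Fin q) ℝ → ℝ,
      AnalyticOnNhd ℝ J {K | IsStableMatrix (Acl A B C K)} ∧
      ∀ K, IsStableMatrix (Acl A B C K) →
        ∀ X : Matrix (Fin n ⊕ Fin q) (Fin n ⊕ Fin q) ℝ, X.IsSymm →
          Acl A B C K * X + X * (Acl A B C K)ᵀ + MW W V K = 0 →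
          J K = (MQ Q R K * X).trace := by
  have : FiniteDimensional ℝ (Matrix (Fin n ⊕ Fin q) (Fin n ⊕ Fin q) ℝ) := inferInstance
  obtain ⟨S, hS, hSan⟩ := exists_analytic_solver (lyapOp (Fin n ⊕ Fin q))
  refine ⟨fun K => (MQ Q R K * S (Acl A B C K) (-(MW W V K))).trace, ?_, ?_⟩
  · intro K hK
    have h1 : AnalyticAt ℝ (fun K : Matrix (Fin q) (Fin q) ℝ × Matrix (Fin q) (Fin p) ℝ × Matrix (Fin m) (Fin q) ℝ => K.1) K := analyticAt_fst
    have h2 : AnalyticAt ℝ (fun K : Matrix (Fin q) (Fin q) ℝ × Matrix (Fin q) (Fin p) ℝ × Matrix (Fin m) (Fin q) ℝ => K.2.1) K :=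
      ((ContinuousLinearMap.fst ℝ _ _).comp (ContinuousLinearMap.snd ℝ _ _)).analyticAt K
    have h3 : AnalyticAt ℝ (fun K : Matrix (Fin q) (Fin q) ℝ × Matrix (Fin q) (Fin p) ℝ × Matrix (Fin m) (Fin q) ℝ => K.2.2) K :=
      ((ContinuousLinearMap.snd ℝ _ _).comp (ContinuousLinearMap.snd ℝ _ _)).analyticAt K
    have hA : AnalyticAt ℝ (fun K => Acl A B C K) K :=
      an_blocks analyticAt_const (an_mul analyticAt_const h3) (an_mul h2 analyticAt_const) h1
    have hMW : AnalyticAt ℝ (fun K => MW (m := m) W V K) K :=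
      an_blocks analyticAt_const analyticAt_const analyticAt_const
        (an_mul (an_mul h2 analyticAt_const) (an_tr h2))
    have hMQ : AnalyticAt ℝ (fun K => MQ (p := p) Q R K) K :=
      an_blocks analyticAt_const analyticAt_const analyticAt_const
        (an_mul (an_mul (an_tr h3) analyticAt_const) h3)
    have hX := hSan _ _ K hA hMW.neg (lyapOp_injective _ hK)
    have hP := an_mul hMQ hX
    simp only [Matrix.trace, Matrix.diag]
    exact Finset.analyticAt_fun_sum _ fun i _ => analyticAt_pi_iff.1 (analyticAt_pi_iff.1 hP i) i
  · intro K hK X _ hX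
    have h1 : -(MW W V K) = lyapOp _ (Acl A B C K) X := by
      rw [lyapOp_apply]; exact (eq_neg_of_add_eq_zero_left hX).symm
    have h2 := hS _ (lyapOp_injective _ hK) X
    simp only [h1, h2]
end
end

section
/- Let q ≥ 1 and let T ∈ ℝ^{q×q} be invertible. Then: (i) 𝒯(T, K) ∈ 𝒞_q for every K ∈ 𝒞_q; (ii) the map K ↦ 𝒯(T, K) is a bijection from 𝒞_q onto itself, with inverse K ↦ 𝒯(T⁻¹, K); (iii) both this map and its inverse are continuous, so K ↦ 𝒯(T, K) is a homeomorphism of 𝒞_q onto itself. -/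
open Matrix

noncomputable section

/-- Similarity transformation of a controller:
`𝒯(T, (A_K, B_K, C_K)) = (T A_K T⁻¹, T B_K, C_K T⁻¹)`. -/
def simT {m p q : ℕ} (T : Matrix (Fin q) (Fin q) ℝ)
    (K : Matrix (Fin q) (Fin q) ℝ × Matrix (Fin q) (Fin p) ℝ × Matrix (Fin m) (Fin q) ℝ) :
    Matrix (Fin q) (Fin q) ℝ × Matrix (Fin q) (Fin p) ℝ × Matrix (Fin m) (Fin q) ℝ :=
  (T * K.1 * T⁻¹, T * K.2.1, K.2.2 * T⁻¹)

theorem simT_inv_left {m p q : ℕ} (T S : Matrix (Fin q) (Fin q) ℝ) (h : S * T = 1)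
    (hS : S⁻¹ = T) (hT : T⁻¹ = S)
    (K : Matrix (Fin q) (Fin q) ℝ × Matrix (Fin q) (Fin p) ℝ × Matrix (Fin m) (Fin q) ℝ) :
    simT S (simT T K) = K := by
  obtain ⟨a, b, c⟩ := K
  simp only [simT, hS, hT, Prod.mk.injEq]
  refine ⟨?_, ?_, ?_⟩
  · calc S * (T * a * S) * T = (S * T) * a * (S * T) := by simp only [Matrix.mul_assoc]
      _ = a := by simp [h]
  · rw [← Matrix.mul_assoc, h, Matrix.one_mul]
  · rw [Matrix.mul_assoc, h, Matrix.mul_one]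

theorem simT_stable {n m p q : ℕ}
    (A : Matrix (Fin n) (Fin n) ℝ) (B : Matrix (Fin n) (Fin m) ℝ)
    (C : Matrix (Fin p) (Fin n) ℝ) (T : Matrix (Fin q) (Fin q) ℝ) (hT : IsUnit T.det)
    (K : Matrix (Fin q) (Fin q) ℝ × Matrix (Fin q) (Fin p) ℝ × Matrix (Fin m) (Fin q) ℝ)
    (hK : IsStableMatrix (Acl A B C K)) : IsStableMatrix (Acl A B C (simT T K)) := by
  let P : Matrix (Fin n ⊕ Fin q) (Fin n ⊕ Fin q) ℝ := fromBlocks 1 0 0 T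
  let Q : Matrix (Fin n ⊕ Fin q) (Fin n ⊕ Fin q) ℝ := fromBlocks 1 0 0 T⁻¹
  have hPQ : P * Q = 1 := by
    simp [P, Q, fromBlocks_multiply, Matrix.mul_nonsing_inv _ hT, fromBlocks_one]
  have hQP : Q * P = 1 := by
    simp [P, Q, fromBlocks_multiply, Matrix.nonsing_inv_mul _ hT, fromBlocks_one]
  have hconj : Acl A B C (simT T K) = P * Acl A B C K * Q := by
    simp [P, Q, Acl, simT, fromBlocks_multiply, Matrix.mul_assoc]
  let f : Matrix (Fin n ⊕ Fin q) (Fin n ⊕ Fin q) ℝ →+* Matrix (Fin n ⊕ Fin q) (Fin n ⊕ Fin q) ℂ :=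
    (algebraMap ℝ ℂ).mapMatrix
  let u : (Matrix (Fin n ⊕ Fin q) (Fin n ⊕ Fin q) ℂ)ˣ :=
    ⟨f P, f Q, by rw [← map_mul, hPQ, map_one], by rw [← map_mul, hQP, map_one]⟩
  have hs : spectrum ℂ (f (Acl A B C (simT T K))) = spectrum ℂ (f (Acl A B C K)) := by
    rw [hconj, map_mul, map_mul]
    exact spectrum.units_conjugate (R := ℂ) (a := f (Acl A B C K)) (u := u)
  intro μ hμ
  apply hK μ
  change μ ∈ spectrum ℂ (f _) at hμ
  change μ ∈ spectrum ℂ (f _)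
  rwa [hs] at hμ

theorem simT_continuous {m p q : ℕ} (T : Matrix (Fin q) (Fin q) ℝ) :
    Continuous (simT T : Matrix (Fin q) (Fin q) ℝ × Matrix (Fin q) (Fin p) ℝ ×
      Matrix (Fin m) (Fin q) ℝ → _) := by
  unfold simT
  fun_prop

/-- For invertible `T`, the similarity transformation `K ↦ 𝒯(T, K)` maps
`𝒞_q` into itself, is a bijection of `𝒞_q` onto itself with inverse `K ↦ 𝒯(T⁻¹, K)`, and
both maps are continuous on `𝒞_q`; hence it is a homeomorphism of `𝒞_q` onto itself. -/
theorem simT_homeomorph_Cq (n m p q : ℕ)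
    (hn : 0 < n) (hm : 0 < m) (hp : 0 < p) (hq : 1 ≤ q)
    (A : Matrix (Fin n) (Fin n) ℝ) (B : Matrix (Fin n) (Fin m) ℝ)
    (C : Matrix (Fin p) (Fin n) ℝ)
    (T : Matrix (Fin q) (Fin q) ℝ) (hT : IsUnit T.det) :
    (∀ K ∈ {K : Matrix (Fin q) (Fin q) ℝ × Matrix (Fin q) (Fin p) ℝ × Matrix (Fin m) (Fin q) ℝ |
        IsStableMatrix (Acl A B C K)}, simT T K ∈ {K | IsStableMatrix (Acl A B C K)}) ∧
    Set.BijOn (simT T)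
      {K : Matrix (Fin q) (Fin q) ℝ × Matrix (Fin q) (Fin p) ℝ × Matrix (Fin m) (Fin q) ℝ |
        IsStableMatrix (Acl A B C K)}
      {K | IsStableMatrix (Acl A B C K)} ∧
    (∀ K ∈ {K : Matrix (Fin q) (Fin q) ℝ × Matrix (Fin q) (Fin p) ℝ × Matrix (Fin m) (Fin q) ℝ |
        IsStableMatrix (Acl A B C K)}, simT T⁻¹ (simT T K) = K) ∧
    (∀ K ∈ {K : Matrix (Fin q) (Fin q) ℝ × Matrix (Fin q) (Fin p) ℝ × Matrix (Fin m) (Fin q) ℝ |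
        IsStableMatrix (Acl A B C K)}, simT T (simT T⁻¹ K) = K) ∧
    ContinuousOn (simT T)
      {K : Matrix (Fin q) (Fin q) ℝ × Matrix (Fin q) (Fin p) ℝ × Matrix (Fin m) (Fin q) ℝ |
        IsStableMatrix (Acl A B C K)} ∧
    ContinuousOn (simT T⁻¹)
      {K : Matrix (Fin q) (Fin q) ℝ × Matrix (Fin q) (Fin p) ℝ × Matrix (Fin m) (Fin q) ℝ |
        IsStableMatrix (Acl A B C K)} := by
  have hTi : IsUnit (T⁻¹).det := Matrix.isUnit_nonsing_inv_det _ hT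
  have hii : T⁻¹⁻¹ = T := Matrix.nonsing_inv_nonsing_inv _ hT
  have h1 := simT_inv_left (m := m) (p := p) T T⁻¹ (Matrix.nonsing_inv_mul _ hT) hii rfl
  have h2 := simT_inv_left (m := m) (p := p) T⁻¹ T (Matrix.mul_nonsing_inv _ hT) rfl hii
  have m1 := simT_stable A B C T hT
  have m2 := simT_stable A B C T⁻¹ hTi
  refine ⟨m1, ⟨m1, fun K _ L _ h => ?_, fun K hK => ⟨_, m2 K hK, h2 K⟩⟩, fun K _ => h1 K,
    fun K _ => h2 K, (simT_continuous T).continuousOn, (simT_continuous T⁻¹).continuousOn⟩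
  rw [← h1 K, h, h1 L]
end
end

section
/- Suppose ℱ_n is nonempty, and set 𝒢_n^+ := {Z ∈ 𝒢_n : det Π > 0} and 𝒢_n^- := {Z ∈ 𝒢_n : det Π < 0}. Then 𝒢_n^+ and 𝒢_n^- are nonempty, disjoint, their union is 𝒢_n, each of them is path-connected, and no continuous path lying inside 𝒢_n joins a point of 𝒢_n^+ to a point of 𝒢_n^-; that is, 𝒢_n has exactly two path-connected components. -/
open Matrix

noncomputable section

/-- The parameter space of the convex lifting:
tuples `Z = (X, Y, M, H, F, Π, Ξ)`. -/
abbrev GType (n m p : ℕ) :=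
  Matrix (Fin n) (Fin n) ℝ × Matrix (Fin n) (Fin n) ℝ × Matrix (Fin n) (Fin n) ℝ ×
    Matrix (Fin n) (Fin p) ℝ × Matrix (Fin m) (Fin n) ℝ ×
    Matrix (Fin n) (Fin n) ℝ × Matrix (Fin n) (Fin n) ℝ

/-- The matrix `N = [[A·X + B·F, A],[M, Y·A + H·C]]` appearing in the definition of `ℱ_n`. -/
def Nmat {n m p : ℕ} (A : Matrix (Fin n) (Fin n) ℝ) (B : Matrix (Fin n) (Fin m) ℝ)
    (C : Matrix (Fin p) (Fin n) ℝ) (X Y M : Matrix (Fin n) (Fin n) ℝ)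
    (H : Matrix (Fin n) (Fin p) ℝ) (F : Matrix (Fin m) (Fin n) ℝ) :
    Matrix (Fin n ⊕ Fin n) (Fin n ⊕ Fin n) ℝ :=
  fromBlocks (A * X + B * F) A M (Y * A + H * C)

/-- Membership in the convex set `ℱ_n`. -/
def memF {n m p : ℕ} (A : Matrix (Fin n) (Fin n) ℝ) (B : Matrix (Fin n) (Fin m) ℝ)
    (C : Matrix (Fin p) (Fin n) ℝ) (X Y M : Matrix (Fin n) (Fin n) ℝ)
    (H : Matrix (Fin n) (Fin p) ℝ) (F : Matrix (Fin m) (Fin n) ℝ) : Prop :=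
  X.IsSymm ∧ Y.IsSymm ∧ (fromBlocks X (1 : Matrix (Fin n) (Fin n) ℝ) 1 Y).PosDef ∧
    (-(Nmat A B C X Y M H F + (Nmat A B C X Y M H F)ᵀ)).PosDef

/-- The set `𝒢_n`. -/
def Gset {n m p : ℕ} (A : Matrix (Fin n) (Fin n) ℝ) (B : Matrix (Fin n) (Fin m) ℝ)
    (C : Matrix (Fin p) (Fin n) ℝ) : Set (GType n m p) :=
  {Z | memF A B C Z.1 Z.2.1 Z.2.2.1 Z.2.2.2.1 Z.2.2.2.2.1 ∧
    Z.2.2.2.2.2.2 * Z.2.2.2.2.2.1 = 1 - Z.2.1 * Z.1}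

lemma tv_apply {n : ℕ} (i j : Fin n) (c : ℝ) (M : Matrix (Fin n) (Fin n) ℝ) (k l : Fin n) :
    (transvection i j c * M) k l = M k l + if k = i then c * M j l else 0 := by
  by_cases h : k = i
  · subst h; simp
  · simp [h]

lemma diag2n_eq_transvections {n : ℕ} {i j : Fin n} (hij : i ≠ j) (a : ℝ) (ha : a ≠ 0) :
    (SpecialLinearGroup.diag2n hij a ha).1 =
      transvection i j a * (transvection j i (-a⁻¹) * (transvection i j a *
        (transvection i j (-1) * (transvection j i 1 * (transvection i j (-1) * 1))))) := by
  have hji := hij.symm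
  ext k l
  rw [SpecialLinearGroup.diag2n_coe]
  simp only [tv_apply, diagonal_apply, one_apply]
  by_cases h1 : k = i
  · subst h1
    by_cases h2 : l = k
    · subst h2; simp [hij, hji, inv_mul_cancel₀ ha]
    · by_cases h3 : l = j
      · subst h3; simp [hij, hji, ha]
      · simp [hij, hji, Ne.symm h2, Ne.symm h3]
  · by_cases h4 : k = j
    · subst h4
      by_cases h2 : l = k
      · subst h2; simp [hij, hji, ha]
      · by_cases h3 : l = i
        · subst h3; simp [hij, hji, ha]
        · simp [hij, hji, Ne.symm h2, Ne.symm h3]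
    · simp [h1, h4]

lemma joined_mul {n : ℕ} {A B : Matrix (Fin n) (Fin n) ℝ}
    (hA : JoinedIn {P : Matrix (Fin n) (Fin n) ℝ | 0 < P.det} 1 A)
    (hB : JoinedIn {P : Matrix (Fin n) (Fin n) ℝ | 0 < P.det} 1 B) :
    JoinedIn {P : Matrix (Fin n) (Fin n) ℝ | 0 < P.det} 1 (A * B) := by
  have h := (hA.mul hB).mono (V := {P : Matrix (Fin n) (Fin n) ℝ | 0 < P.det}) (by
    rintro _ ⟨P, hP, Q, hQ, rfl⟩
    have hP' : 0 < P.det := hP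
    have hQ' : 0 < Q.det := hQ
    simp only [Set.mem_setOf_eq, det_mul]
    positivity)
  simpa using h

lemma joined_transvection {n : ℕ} {i j : Fin n} (hij : i ≠ j) (c : ℝ) :
    JoinedIn {P : Matrix (Fin n) (Fin n) ℝ | 0 < P.det} 1 (transvection i j c) := by
  refine JoinedIn.ofLine (f := fun t => transvection i j (t * c)) ?_ (by simp) (by simp) ?_
  · have : (fun t : ℝ => transvection i j (t * c)) = fun t => 1 + t • Matrix.single i j c := by
      funext t; simp [transvection, smul_single]
    rw [this]
    fun_prop
  · rintro _ ⟨t, -, rfl⟩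
    simp [det_transvection_of_ne i j hij]

lemma joined_one_of_det_one {n : ℕ} (A : SpecialLinearGroup (Fin n) ℝ) :
    JoinedIn {P : Matrix (Fin n) (Fin n) ℝ | 0 < P.det} 1 A.1 := by
  have h1 : JoinedIn {P : Matrix (Fin n) (Fin n) ℝ | 0 < P.det} 1 1 := JoinedIn.refl (by simp)
  rcases subsingleton_or_nontrivial (Fin n) with hs | hs
  · have : A = 1 := Subsingleton.elim _ _
    rw [this]; exact h1
  · refine SpecialLinearGroup.diagonal_transvection_induction'
      (P := fun A => JoinedIn {P : Matrix (Fin n) (Fin n) ℝ | 0 < P.det} 1 A.1) A ?_ ?_ ?_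
    · intro i j hij c hc
      rw [diag2n_eq_transvections]
      have a := fun c => joined_transvection hij c
      have b := fun c => joined_transvection hij.symm c
      exact joined_mul (a _) (joined_mul (b _) (joined_mul (a _) (joined_mul (a _)
        (joined_mul (b _) (joined_mul (a _) h1)))))
    · intro i j hij a
      exact joined_transvection hij a
    · intro A B hA hB
      exact joined_mul hA hB

lemma det_diag_update {n : ℕ} (i : Fin n) (d : ℝ) :
    (diagonal (Function.update (1 : Fin n → ℝ) i d)).det = d := by
  rw [det_diagonal, Finset.prod_update_of_mem (Finset.mem_univ i)]
  simp

lemma isPathConnected_det_pos {n : ℕ} (hn : 0 < n) :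
    IsPathConnected {P : Matrix (Fin n) (Fin n) ℝ | 0 < P.det} := by
  refine ⟨1, by simp, ?_⟩
  intro A hA
  have hA' : 0 < A.det := hA
  let i : Fin n := ⟨0, hn⟩
  let D : ℝ → Matrix (Fin n) (Fin n) ℝ := fun d => diagonal (Function.update (1 : Fin n → ℝ) i d)
  have hD1 : D 1 = 1 := by simp [D]
  have hDm : ∀ a b, D a * D b = D (a * b) := by
    intro a b
    simp only [D, diagonal_mul_diagonal]
    congr 1
    funext k
    by_cases h : k = i
    · subst h; simp
    · simp [h]
  have hDc : Continuous D := by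
    unfold D
    exact Continuous.matrix_diagonal (continuous_const.update i continuous_id)
  have hj : JoinedIn {P : Matrix (Fin n) (Fin n) ℝ | 0 < P.det} 1 (D A.det) := by
    refine JoinedIn.ofLine (f := fun t => D (1 - t + t * A.det)) ?_ (by simp [hD1]) (by simp) ?_
    · exact (hDc.comp (by fun_prop)).continuousOn
    · rintro _ ⟨t, ⟨h0, h1⟩, rfl⟩
      simp only [Set.mem_setOf_eq, D, det_diag_update]
      rcases h0.eq_or_lt with h | h
      · subst h; simp
      · have := mul_pos h hA'
        linarith
  have hS : (D A.det⁻¹ * A).det = 1 := by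
    rw [det_mul, det_diag_update, inv_mul_cancel₀ hA'.ne']
  have := joined_mul hj (joined_one_of_det_one ⟨_, hS⟩)
  simpa [← Matrix.mul_assoc, hDm, hA'.ne', hD1] using this

lemma isPathConnected_det_neg {n : ℕ} (hn : 0 < n) :
    IsPathConnected {P : Matrix (Fin n) (Fin n) ℝ | P.det < 0} := by
  let R : Matrix (Fin n) (Fin n) ℝ := diagonal (Function.update (1 : Fin n → ℝ) ⟨0, hn⟩ (-1))
  have hR : R.det = -1 := det_diag_update _ _
  have hRR : R * R = 1 := by
    simp only [R, diagonal_mul_diagonal]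
    rw [← diagonal_one]
    congr 1
    funext k
    by_cases h : k = ⟨0, hn⟩
    · subst h; simp
    · simp [h]
  have h := (isPathConnected_det_pos hn).image (f := fun P => R * P) (by fun_prop)
  convert h using 1
  ext P
  constructor
  · intro hP
    refine ⟨R * P, ?_, by simp [← Matrix.mul_assoc, hRR]⟩
    have hP' : P.det < 0 := hP
    simp only [Set.mem_setOf_eq, det_mul, hR]
    linarith
  · rintro ⟨Q, hQ, rfl⟩
    have hQ' : 0 < Q.det := hQ
    simp only [Set.mem_setOf_eq, det_mul, hR]
    linarith

lemma posDef_convex {ι : Type*} [Fintype ι] {P Q : Matrix ι ι ℝ} (hP : P.PosDef) (hQ : Q.PosDef)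
    {a b : ℝ} (ha : 0 ≤ a) (hb : 0 ≤ b) (hab : a + b = 1) : (a • P + b • Q).PosDef := by
  rcases ha.eq_or_lt with h | h
  · subst h
    have : b = 1 := by linarith
    simpa [this] using hQ
  · exact (hP.smul h).add_posSemidef (hQ.posSemidef.smul hb)

/-- The set `ℱ_n` as a set of tuples. -/
def Fset {n m p : ℕ} (A : Matrix (Fin n) (Fin n) ℝ) (B : Matrix (Fin n) (Fin m) ℝ)
    (C : Matrix (Fin p) (Fin n) ℝ) : Set (Matrix (Fin n) (Fin n) ℝ × Matrix (Fin n) (Fin n) ℝ ×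
      Matrix (Fin n) (Fin n) ℝ × Matrix (Fin n) (Fin p) ℝ × Matrix (Fin m) (Fin n) ℝ) :=
  {W | memF A B C W.1 W.2.1 W.2.2.1 W.2.2.2.1 W.2.2.2.2}

lemma convex_Fset {n m p : ℕ} (A : Matrix (Fin n) (Fin n) ℝ) (B : Matrix (Fin n) (Fin m) ℝ)
    (C : Matrix (Fin p) (Fin n) ℝ) : Convex ℝ (Fset A B C) := by
  rintro ⟨X, Y, M, H, F⟩ ⟨hX, hY, hP, hN⟩ ⟨X', Y', M', H', F'⟩ ⟨hX', hY', hP', hN'⟩ a b ha hb hab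
  dsimp only at *
  refine ⟨(hX.smul a).add (hX'.smul b), (hY.smul a).add (hY'.smul b), ?_, ?_⟩
  · convert posDef_convex hP hP' ha hb hab using 1
    simp only [fromBlocks_smul, fromBlocks_add, ← add_smul, hab, one_smul]
    rfl
  · convert posDef_convex hN hN' ha hb hab using 1
    have hA : A = a • A + b • A := by rw [← add_smul, hab, one_smul]
    have : Nmat A B C (a • X + b • X') (a • Y + b • Y') (a • M + b • M') (a • H + b • H')
        (a • F + b • F') = a • Nmat A B C X Y M H F + b • Nmat A B C X' Y' M' H' F' := by
      simp only [Nmat, fromBlocks_smul, fromBlocks_add]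
      rw [← hA]
      simp only [Matrix.mul_add, Matrix.add_mul, Matrix.mul_smul, Matrix.smul_mul, smul_add]
      congr 1 <;> abel
    simp only [Prod.smul_mk, Prod.mk_add_mk]
    rw [this]
    simp only [transpose_add, transpose_smul, smul_neg, smul_add]
    abel

lemma det_ne_zero_of_posDef {n : ℕ} {X Y : Matrix (Fin n) (Fin n) ℝ}
    (h : (fromBlocks X (1 : Matrix (Fin n) (Fin n) ℝ) 1 Y).PosDef) : (1 - Y * X).det ≠ 0 := by
  have hX : X.PosDef := by
    have := h.submatrix (e := Sum.inl) Sum.inl_injective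
    exact this
  have hd := h.det_pos
  haveI : Invertible X := X.invertibleOfIsUnitDet hX.det_pos.ne'.isUnit
  rw [det_fromBlocks₁₁] at hd
  have h2 : (1 - Y * X) = -((Y - 1 * ⅟X * 1) * X) := by
    simp [Matrix.sub_mul]
  rw [h2, det_neg, det_mul]
  have h3 : (Y - 1 * ⅟X * 1).det ≠ 0 := right_ne_zero_of_mul hd.ne'
  exact mul_ne_zero (by simp) (mul_ne_zero h3 hX.det_pos.ne')

lemma det_ne_zero_of_mem {n m p : ℕ} {A : Matrix (Fin n) (Fin n) ℝ} {B : Matrix (Fin n) (Fin m) ℝ}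
    {C : Matrix (Fin p) (Fin n) ℝ} {Z : GType n m p} (hZ : Z ∈ Gset A B C) :
    Z.2.2.2.2.2.1.det ≠ 0 := by
  intro h0
  have h := det_ne_zero_of_posDef hZ.1.2.2.1
  rw [← hZ.2, det_mul, h0] at h
  simp at h

lemma isPathConnected_lift {n m p : ℕ} {A : Matrix (Fin n) (Fin n) ℝ}
    {B : Matrix (Fin n) (Fin m) ℝ} {C : Matrix (Fin p) (Fin n) ℝ} (hF : (Fset A B C).Nonempty)
    {s : Set ℝ} (h0 : (0 : ℝ) ∉ s)
    (hs : IsPathConnected {P : Matrix (Fin n) (Fin n) ℝ | P.det ∈ s}) :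
    IsPathConnected {Z ∈ Gset A B C | Z.2.2.2.2.2.1.det ∈ s} := by
  have h1 := ((convex_Fset A B C).isPathConnected hF).prod hs
  have h2 := h1.image' (Y := GType n m p) (f := fun q =>
    (q.1.1, q.1.2.1, q.1.2.2.1, q.1.2.2.2.1, q.1.2.2.2.2, q.2, (1 - q.1.2.1 * q.1.1) * q.2⁻¹)) (by
      have hinv : ContinuousOn (fun P : Matrix (Fin n) (Fin n) ℝ => P⁻¹)
          {P : Matrix (Fin n) (Fin n) ℝ | P.det ∈ s} := by
        intro P hP
        refine (continuousAt_matrix_inv P ?_).continuousWithinAt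
        have hne : P.det ≠ 0 := fun h => h0 (h ▸ hP)
        simpa using continuousAt_inv₀ hne
      have hinv2 := hinv.comp (t := {P : Matrix (Fin n) (Fin n) ℝ | P.det ∈ s})
        (f := Prod.snd) (s := Fset A B C ×ˢ {P : Matrix (Fin n) (Fin n) ℝ | P.det ∈ s})
        continuous_snd.continuousOn (fun q hq => hq.2)
      have hmul := ContinuousOn.mul (s := Fset A B C ×ˢ {P : Matrix (Fin n) (Fin n) ℝ | P.det ∈ s})
        (f := fun q => 1 - q.1.2.1 * q.1.1) (by fun_prop) hinv2
      simp only [Function.comp_def] at hmul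
      fun_prop)
  convert h2 using 1
  ext ⟨X, Y, M, H, F, P, Q⟩
  constructor
  · rintro ⟨hZ, hP⟩
    have hne : IsUnit P.det := (det_ne_zero_of_mem hZ).isUnit
    refine ⟨((X, Y, M, H, F), P), ⟨hZ.1, hP⟩, ?_⟩
    have hQ : Q * P = 1 - Y * X := hZ.2
    simp only [← hQ, mul_nonsing_inv_cancel_right _ _ hne]
  · rintro ⟨⟨⟨X', Y', M', H', F'⟩, P'⟩, ⟨hW, hP⟩, he⟩
    simp only [Prod.mk.injEq] at he
    obtain ⟨rfl, rfl, rfl, rfl, rfl, rfl, rfl⟩ := he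
    have hne : IsUnit P'.det := (show P'.det ≠ 0 from fun h => h0 (h ▸ hP)).isUnit
    refine ⟨⟨hW, ?_⟩, hP⟩
    exact nonsing_inv_mul_cancel_right _ _ hne

/-- If `ℱ_n ≠ ∅` then `𝒢_n` has exactly two path-connected components,
`𝒢_n⁺ = {Z ∈ 𝒢_n : det Π > 0}` and `𝒢_n⁻ = {Z ∈ 𝒢_n : det Π < 0}`: they are nonempty,
disjoint, their union is `𝒢_n`, each is path-connected, and no continuous path inside
`𝒢_n` joins a point of `𝒢_n⁺` to a point of `𝒢_n⁻`. -/
theorem Gset_two_components (n m p : ℕ) (hn : 0 < n) (hm : 0 < m) (hp : 0 < p)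
    (A : Matrix (Fin n) (Fin n) ℝ) (B : Matrix (Fin n) (Fin m) ℝ)
    (C : Matrix (Fin p) (Fin n) ℝ)
    (hF : ∃ (X Y M : Matrix (Fin n) (Fin n) ℝ) (H : Matrix (Fin n) (Fin p) ℝ)
        (F : Matrix (Fin m) (Fin n) ℝ), memF A B C X Y M H F) :
    ({Z ∈ Gset A B C | 0 < Z.2.2.2.2.2.1.det}).Nonempty ∧
    ({Z ∈ Gset A B C | Z.2.2.2.2.2.1.det < 0}).Nonempty ∧
    Disjoint {Z ∈ Gset A B C | 0 < Z.2.2.2.2.2.1.det}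
      {Z ∈ Gset A B C | Z.2.2.2.2.2.1.det < 0} ∧
    {Z ∈ Gset A B C | 0 < Z.2.2.2.2.2.1.det} ∪ {Z ∈ Gset A B C | Z.2.2.2.2.2.1.det < 0}
      = Gset A B C ∧
    IsPathConnected {Z ∈ Gset A B C | 0 < Z.2.2.2.2.2.1.det} ∧
    IsPathConnected {Z ∈ Gset A B C | Z.2.2.2.2.2.1.det < 0} ∧
    (∀ Z ∈ {Z ∈ Gset A B C | 0 < Z.2.2.2.2.2.1.det},
      ∀ Z' ∈ {Z ∈ Gset A B C | Z.2.2.2.2.2.1.det < 0},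
        ¬ JoinedIn (Gset A B C) Z Z') := by
  have hF' : (Fset A B C).Nonempty := by
    obtain ⟨X, Y, M, H, F, h⟩ := hF
    exact ⟨(X, Y, M, H, F), h⟩
  have hpos : IsPathConnected {Z ∈ Gset A B C | 0 < Z.2.2.2.2.2.1.det} :=
    isPathConnected_lift hF' (s := Set.Ioi 0) (by simp) (isPathConnected_det_pos hn)
  have hneg : IsPathConnected {Z ∈ Gset A B C | Z.2.2.2.2.2.1.det < 0} :=
    isPathConnected_lift hF' (s := Set.Iio 0) (by simp) (isPathConnected_det_neg hn)
  refine ⟨hpos.nonempty, hneg.nonempty, ?_, ?_, hpos, hneg, ?_⟩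
  · rw [Set.disjoint_left]
    rintro Z ⟨-, h⟩ ⟨-, h'⟩
    exact lt_asymm h h'
  · ext Z
    constructor
    · rintro (h | h) <;> exact h.1
    · intro h
      rcases lt_or_gt_of_ne (det_ne_zero_of_mem h) with h' | h'
      · exact Or.inr ⟨h, h'⟩
      · exact Or.inl ⟨h, h'⟩
  · rintro Z ⟨-, hZ⟩ Z' ⟨-, hZ'⟩ ⟨γ, hγ⟩
    have hc : Continuous fun t => (γ t).2.2.2.2.2.1.det := by
      apply Continuous.matrix_det
      have := γ.continuous
      fun_prop
    obtain ⟨t, ht⟩ := mem_range_of_exists_le_of_exists_ge (c := (0 : ℝ)) hc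
      ⟨1, by simpa using hZ'.le⟩ ⟨0, by simpa using hZ.le⟩
    exact det_ne_zero_of_mem (hγ t) ht
end
end

section
/- Assume n ≥ 1, (A, B) is controllable, (C, A) is observable, and the plant is single-input or single-output, i.e. m = 1 or p = 1. Then the set 𝒞_n of full-order stabilizing controllers is path-connected if and only if there exists a stabilizing controller of order n−1, i.e. 𝒞_{n−1} ≠ ∅. -/
open Matrix

noncomputable section

/-- `(A, B)` is controllable: the controllability matrix `[B, A·B, …, A^{r−1}·B]` has
rank `r`. -/
def Controllable {r s : ℕ} (A : Matrix (Fin r) (Fin r) ℝ) (B : Matrix (Fin r) (Fin s) ℝ) :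
    Prop :=
  (Matrix.of fun (i : Fin r) (kj : Fin r × Fin s) => (A ^ (kj.1 : ℕ) * B) i kj.2).rank = r

/-- The set `𝒞_q` of stabilizing controllers of order `q` for the plant `(A, B, C)`. -/
def Cset {n m p : ℕ} (A : Matrix (Fin n) (Fin n) ℝ) (B : Matrix (Fin n) (Fin m) ℝ)
    (C : Matrix (Fin p) (Fin n) ℝ) (q : ℕ) :
    Set (Matrix (Fin q) (Fin q) ℝ × Matrix (Fin q) (Fin p) ℝ × Matrix (Fin m) (Fin q) ℝ) :=
  {K | IsStableMatrix (fromBlocks A (B * K.2.2) (K.2.1 * C) K.1)}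


/-! ### Path components of the general linear group -/

/-- The reflection in coordinate `i`. -/
def reflMat {k : Type*} [DecidableEq k] (i : k) : Matrix k k ℝ :=
  diagonal (fun j => if j = i then -1 else 1)

lemma reflMat_mul_self {k : Type*} [Fintype k] [DecidableEq k] (i : k) :
    reflMat i * reflMat i = 1 := by
  rw [reflMat, diagonal_mul_diagonal, ← diagonal_one]
  congr 1; ext j; split_ifs <;> simp

lemma det_reflMat {k : Type*} [Fintype k] [DecidableEq k] (i : k) :
    (reflMat i).det = -1 := by
  simp [reflMat, det_diagonal, Finset.prod_ite_eq']

lemma joined_mul_s10 {k : Type*} [Fintype k] [DecidableEq k] {a b c d : Matrix k k ℝ}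
    (h1 : JoinedIn {M : Matrix k k ℝ | M.det ≠ 0} a b)
    (h2 : JoinedIn {M : Matrix k k ℝ | M.det ≠ 0} c d) :
    JoinedIn {M : Matrix k k ℝ | M.det ≠ 0} (a * c) (b * d) := by
  refine (h1.mul h2).mono ?_
  rintro _ ⟨x, hx, y, hy, rfl⟩
  simp only [Set.mem_ofPred_eq] at *
  simp [hx, hy]

lemma joined_transvection_s10 {k : Type*} [Fintype k] [DecidableEq k] (i j : k) (h : i ≠ j) (c : ℝ) :
    JoinedIn {M : Matrix k k ℝ | M.det ≠ 0} 1 (transvection i j c) := by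
  refine JoinedIn.ofLine (f := fun t => transvection i j (t * c)) ?_ ?_ ?_ ?_
  · apply Continuous.continuousOn
    unfold transvection
    refine continuous_const.add ?_
    refine continuous_matrix fun a b => ?_
    simp only [single, of_apply]
    split_ifs <;> fun_prop
  · simp
  · simp
  · rintro _ ⟨t, -, rfl⟩
    simp [det_transvection_of_ne _ _ h]

lemma refl_mul_refl {k : Type*} [Fintype k] [DecidableEq k] (i j : k) (h : i ≠ j) :
    reflMat i * reflMat j = (transvection i j 1 * transvection j i (-1) * transvection i j 1) *
      (transvection i j 1 * transvection j i (-1) * transvection i j 1) := by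
  have h0 : (single j i (-1:ℝ)) = - single j i 1 := by
    ext a b; simp only [single, of_apply, Matrix.neg_apply]; split_ifs <;> simp
  have e1 : (transvection i j (1:ℝ) * transvection j i (-1) * transvection i j 1) =
      1 + single i j 1 - single j i 1 - single i i 1 - single j j 1 := by
    simp only [transvection, h0, add_mul, mul_add, one_mul, mul_one, neg_mul, mul_neg]
    simp [h, h.symm]
    abel
  have e2 : ∀ l : k, reflMat l = 1 - single l l 1 - single l l 1 := by
    intro l
    ext a b
    simp only [reflMat, diagonal_apply, Matrix.sub_apply, Matrix.one_apply, single, of_apply]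
    grind
  rw [e1, e2, e2]
  simp only [add_mul, mul_add, sub_mul, mul_sub, one_mul, mul_one, neg_mul, mul_neg]
  simp [h, h.symm]
  abel

lemma joined_refl_mul_refl {k : Type*} [Fintype k] [DecidableEq k] (i j : k) :
    JoinedIn {M : Matrix k k ℝ | M.det ≠ 0} 1 (reflMat i * reflMat j) := by
  by_cases h : i = j
  · subst h
    rw [reflMat_mul_self]
    exact JoinedIn.refl (by simp)
  · rw [refl_mul_refl i j h]
    have t1 := joined_transvection_s10 i j h 1
    have t2 := joined_transvection_s10 j i (Ne.symm h) (-1)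
    have t3 := joined_mul_s10 (joined_mul_s10 t1 t2) t1
    have t4 := joined_mul_s10 t3 t3
    simpa using t4

/-- Every invertible real matrix can be joined to the identity or to a fixed reflection. -/
lemma joined_GL {k : Type*} [Fintype k] [DecidableEq k] (i₀ : k) (g : Matrix k k ℝ)
    (hg : g.det ≠ 0) :
    JoinedIn {M : Matrix k k ℝ | M.det ≠ 0} 1 g ∨
    JoinedIn {M : Matrix k k ℝ | M.det ≠ 0} (reflMat i₀) g := by
  have hmul : ∀ a b : Matrix k k ℝ,
      (JoinedIn {M : Matrix k k ℝ | M.det ≠ 0} 1 a ∨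
        JoinedIn {M : Matrix k k ℝ | M.det ≠ 0} (reflMat i₀) a) →
      (JoinedIn {M : Matrix k k ℝ | M.det ≠ 0} 1 b ∨
        JoinedIn {M : Matrix k k ℝ | M.det ≠ 0} (reflMat i₀) b) →
      (JoinedIn {M : Matrix k k ℝ | M.det ≠ 0} 1 (a * b) ∨
        JoinedIn {M : Matrix k k ℝ | M.det ≠ 0} (reflMat i₀) (a * b)) := by
    rintro a b (ha | ha) (hb | hb)
    · left; simpa using joined_mul_s10 ha hb
    · right; simpa using joined_mul_s10 ha hb
    · right; simpa using joined_mul_s10 ha hb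
    · left; simpa [reflMat_mul_self] using joined_mul_s10 ha hb
  have hrefl : ∀ i, JoinedIn {M : Matrix k k ℝ | M.det ≠ 0} (reflMat i₀) (reflMat i) := by
    intro i
    have h1 : JoinedIn {M : Matrix k k ℝ | M.det ≠ 0} (reflMat i₀) (reflMat i₀) :=
      JoinedIn.refl (by simp [det_reflMat])
    have := joined_mul_s10 h1 (joined_refl_mul_refl i₀ i)
    rwa [← mul_assoc, reflMat_mul_self, one_mul, mul_one] at this
  have hsign : ∀ s : Finset k,
      (JoinedIn {M : Matrix k k ℝ | M.det ≠ 0} 1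
          (diagonal (fun j => if j ∈ s then (-1 : ℝ) else 1)) ∨
        JoinedIn {M : Matrix k k ℝ | M.det ≠ 0} (reflMat i₀)
          (diagonal (fun j => if j ∈ s then (-1 : ℝ) else 1))) := by
    intro s
    induction s using Finset.induction_on with
    | empty => left; simpa using JoinedIn.refl (by simp)
    | insert i s his ih =>
      have e : (diagonal (fun j => if j ∈ insert i s then (-1 : ℝ) else 1)) =
          reflMat i * diagonal (fun j => if j ∈ s then (-1 : ℝ) else 1) := by
        rw [reflMat, diagonal_mul_diagonal]
        congr 1; ext j
        by_cases hj : j = i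
        · subst hj; simp [his]
        · simp [hj]
      rw [e]
      exact hmul _ _ (Or.inr (hrefl i)) ih
  refine diagonal_transvection_induction_of_det_ne_zero (fun g =>
    JoinedIn {M : Matrix k k ℝ | M.det ≠ 0} 1 g ∨
    JoinedIn {M : Matrix k k ℝ | M.det ≠ 0} (reflMat i₀) g) g hg ?_ ?_ ?_
  · intro D hD
    have hD' : ∀ i, D i ≠ 0 := by
      rw [det_diagonal] at hD
      intro i
      exact (Finset.prod_ne_zero_iff.mp hD) i (Finset.mem_univ i)
    have key : JoinedIn {M : Matrix k k ℝ | M.det ≠ 0}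
        (diagonal (fun j => if j ∈ Finset.univ.filter (fun i => D i < 0) then (-1 : ℝ) else 1))
        (diagonal D) := by
      refine JoinedIn.ofLine (f := fun t => diagonal (fun j =>
        (1 - t) * (if D j < 0 then (-1 : ℝ) else 1) + t * D j)) ?_ ?_ ?_ ?_
      · apply Continuous.continuousOn
        apply Continuous.matrix_diagonal
        fun_prop
      · simp
      · simp
      · rintro _ ⟨t, ht, rfl⟩
        simp only [Set.mem_ofPred_eq, det_diagonal]
        refine Finset.prod_ne_zero_iff.mpr fun i _ => ?_
        obtain ⟨h0, h1⟩ := ht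
        have := hD' i
        rcases eq_or_lt_of_le h0 with h0 | h0
        · subst h0
          split_ifs <;> simp
        split_ifs with hi
        · have := mul_neg_of_pos_of_neg h0 hi
          apply ne_of_lt
          linarith
        · have : 0 < D i := lt_of_le_of_ne (not_lt.mp hi) (Ne.symm this)
          have := mul_pos h0 this
          apply ne_of_gt
          linarith
    exact (hsign _).imp (fun h => h.trans key) (fun h => h.trans key)
  · intro t
    left
    exact joined_transvection_s10 _ _ t.hij _
  · intro a b _ _ ha hb
    exact hmul a b ha hb

/-! ### Elementary facts on stable matrices -/

section stab
variable {k l : Type*} [Fintype k] [DecidableEq k] [Fintype l] [DecidableEq l]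

lemma stable_iff_charpoly (M : Matrix k k ℝ) :
    IsStableMatrix M ↔ ∀ μ : ℂ, (M.charpoly.map (algebraMap ℝ ℂ)).IsRoot μ → μ.re < 0 := by
  unfold IsStableMatrix
  simp only [Matrix.mem_spectrum_iff_isRoot_charpoly, Matrix.charpoly_map]

lemma stable_of_charpoly_eq {M : Matrix k k ℝ} {N : Matrix l l ℝ}
    (h : M.charpoly = N.charpoly) (hM : IsStableMatrix M) : IsStableMatrix N := by
  rw [stable_iff_charpoly] at *
  rwa [← h]

lemma stable_transpose {M : Matrix k k ℝ} (hM : IsStableMatrix M) : IsStableMatrix Mᵀ :=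
  stable_of_charpoly_eq (Matrix.charpoly_transpose M).symm hM

lemma stable_blockdiag {M : Matrix k k ℝ} {N : Matrix l l ℝ} (hM : IsStableMatrix M)
    (hN : IsStableMatrix N) : IsStableMatrix (fromBlocks M 0 0 N) := by
  rw [stable_iff_charpoly] at *
  rw [Matrix.charpoly_fromBlocks_zero₂₁]
  intro μ h
  rw [Polynomial.map_mul, Polynomial.IsRoot, Polynomial.eval_mul, mul_eq_zero] at h
  rcases h with h | h
  · exact hM μ h
  · exact hN μ h

lemma stable_neg_one : IsStableMatrix (-1 : Matrix Unit Unit ℝ) := by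
  rw [stable_iff_charpoly]
  intro μ h
  simp [Matrix.charpoly, Matrix.charmatrix_apply, Polynomial.IsRoot] at h
  have : μ = -1 := by linear_combination h
  simp [this]

lemma stable_iff_vec (M : Matrix k k ℝ) :
    IsStableMatrix M ↔ ∀ (μ : ℂ) (v : k → ℂ), v ≠ 0 →
      (M.map (algebraMap ℝ ℂ)) *ᵥ v = μ • v → μ.re < 0 := by
  have key : ∀ μ : ℂ, μ ∈ spectrum ℂ (M.map (algebraMap ℝ ℂ)) ↔
      ∃ v : k → ℂ, v ≠ 0 ∧ (M.map (algebraMap ℝ ℂ)) *ᵥ v = μ • v := by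
    intro μ
    rw [spectrum.mem_iff, Matrix.isUnit_iff_isUnit_det, isUnit_iff_ne_zero, not_not,
      ← Matrix.exists_mulVec_eq_zero_iff]
    refine exists_congr fun v => and_congr Iff.rfl ?_
    rw [Matrix.sub_mulVec, sub_eq_zero, Algebra.algebraMap_eq_smul_one, Matrix.smul_mulVec,
      Matrix.one_mulVec, eq_comm]
  unfold IsStableMatrix
  simp only [key]
  grind

lemma stable_of_intertwine {M : Matrix k k ℝ} {N : Matrix l l ℝ} (E : Matrix k l ℝ)
    (Q : Matrix l k ℝ) (hQE : Q * E = 1) (h : M * E = E * N) (hM : IsStableMatrix M) :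
    IsStableMatrix N := by
  rw [stable_iff_vec] at *
  intro μ v hv hNv
  have h' : M.map (algebraMap ℝ ℂ) * E.map (algebraMap ℝ ℂ) =
      E.map (algebraMap ℝ ℂ) * N.map (algebraMap ℝ ℂ) := by
    rw [← Matrix.map_mul, ← Matrix.map_mul, h]
  have hQE' : Q.map (algebraMap ℝ ℂ) * E.map (algebraMap ℝ ℂ) = 1 := by
    rw [← Matrix.map_mul, hQE]; simp
  refine hM μ (E.map (algebraMap ℝ ℂ) *ᵥ v) ?_ ?_
  · intro h0
    apply hv
    rw [← Matrix.one_mulVec v, ← hQE', ← Matrix.mulVec_mulVec, h0, Matrix.mulVec_zero]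
  · rw [Matrix.mulVec_mulVec, h', ← Matrix.mulVec_mulVec, hNv, Matrix.mulVec_smul]

/-- Sufficiency in Lyapunov's theorem. -/
lemma stable_of_lyap {M P : Matrix k k ℝ} (hP : P.PosDef) (hL : (-(M * P + P * Mᵀ)).PosDef) :
    IsStableMatrix M := by
  suffices h : IsStableMatrix Mᵀ by simpa using stable_transpose h
  rw [stable_iff_vec]
  intro μ z hz h
  set x : k → ℝ := fun i => (z i).re with hx
  set y : k → ℝ := fun i => (z i).im with hy
  have h1 : Mᵀ *ᵥ x = μ.re • x - μ.im • y := by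
    ext i
    have := congrArg Complex.re (congrFun h i)
    simpa [Matrix.mulVec, dotProduct, hx, hy] using this
  have h2 : Mᵀ *ᵥ y = μ.re • y + μ.im • x := by
    ext i
    have := congrArg Complex.im (congrFun h i)
    simpa [Matrix.mulVec, dotProduct, hx, hy] using this
  have hPs : Pᵀ = P := by simpa [Matrix.IsHermitian] using hP.1
  have q : ∀ u : k → ℝ, u ⬝ᵥ ((-(M * P + P * Mᵀ)) *ᵥ u) = - 2 * (u ⬝ᵥ (P *ᵥ (Mᵀ *ᵥ u))) := by
    intro u
    have e1 : u ⬝ᵥ ((M * P) *ᵥ u) = u ⬝ᵥ (P *ᵥ (Mᵀ *ᵥ u)) := by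
      rw [← Matrix.mulVec_mulVec, Matrix.dotProduct_mulVec, ← Matrix.mulVec_transpose,
        Matrix.dotProduct_mulVec, ← Matrix.mulVec_transpose, hPs, dotProduct_comm,
        Matrix.dotProduct_mulVec, ← Matrix.mulVec_transpose, hPs]
    rw [Matrix.neg_mulVec, Matrix.add_mulVec, dotProduct_neg, dotProduct_add, e1,
      ← Matrix.mulVec_mulVec]
    ring
  have hcross : x ⬝ᵥ (P *ᵥ y) = y ⬝ᵥ (P *ᵥ x) := by
    rw [Matrix.dotProduct_mulVec, ← Matrix.mulVec_transpose, hPs, dotProduct_comm]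
  have qx := q x
  have qy := q y
  rw [h1, Matrix.mulVec_sub, Matrix.mulVec_smul, Matrix.mulVec_smul, dotProduct_sub,
    dotProduct_smul, dotProduct_smul] at qx
  rw [h2, Matrix.mulVec_add, Matrix.mulVec_smul, Matrix.mulVec_smul, dotProduct_add,
    dotProduct_smul, dotProduct_smul] at qy
  simp only [smul_eq_mul] at qx qy
  have px := hP.posSemidef.dotProduct_mulVec_nonneg x
  have py := hP.posSemidef.dotProduct_mulVec_nonneg y
  have lx := hL.posSemidef.dotProduct_mulVec_nonneg x
  have ly := hL.posSemidef.dotProduct_mulVec_nonneg y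
  simp only [star_trivial] at px py lx ly
  have hs : 0 < x ⬝ᵥ ((-(M * P + P * Mᵀ)) *ᵥ x) + y ⬝ᵥ ((-(M * P + P * Mᵀ)) *ᵥ y) := by
    by_cases hx0 : x = 0
    · have hy0 : y ≠ 0 := by
        intro hy0
        apply hz
        ext i
        exact Complex.ext (congrFun hx0 i) (congrFun hy0 i)
      have := hL.dotProduct_mulVec_pos hy0
      simp only [star_trivial] at this
      linarith
    · have := hL.dotProduct_mulVec_pos hx0
      simp only [star_trivial] at this
      linarith
  rw [qx, qy, hcross] at hs
  by_contra hμ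
  push Not at hμ
  nlinarith [mul_nonneg hμ px, mul_nonneg hμ py]

/-- Positive definiteness is an open condition among symmetric matrices. -/
lemma posDef_eventually {ι : Type*} {f : Filter ι} (E : ι → Matrix k k ℝ) {P : Matrix k k ℝ}
    (hP : P.PosDef) (hE : Filter.Tendsto E f (nhds P)) (hs : ∀ i, (E i).IsHermitian) :
    ∀ᶠ i in f, (E i).PosDef := by
  have hc : IsCompact (Metric.sphere (0 : k → ℝ) 1) := isCompact_sphere _ _
  have ev : ∀ᶠ Q in nhds P, ∀ v ∈ Metric.sphere (0 : k → ℝ) 1, 0 < v ⬝ᵥ (Q *ᵥ v) := by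
    refine hc.eventually_forall_of_forall_eventually fun v hv => ?_
    have hcont : Continuous (fun z : Matrix k k ℝ × (k → ℝ) => z.2 ⬝ᵥ (z.1 *ᵥ z.2)) := by
      fun_prop
    have hv0 : v ≠ 0 := by
      rintro rfl
      simp at hv
    have := hP.dotProduct_mulVec_pos hv0
    simp only [star_trivial] at this
    exact hcont.continuousAt.eventually (lt_mem_nhds this)
  filter_upwards [hE.eventually ev] with i hi
  refine Matrix.PosDef.of_dotProduct_mulVec_pos (hs i) fun v hv => ?_
  have hn : 0 < ‖v‖ := norm_pos_iff.mpr hv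
  have := hi (‖v‖⁻¹ • v) (by simp [norm_smul, hn.ne'])
  rw [Matrix.mulVec_smul, smul_dotProduct, dotProduct_smul] at this
  simp only [smul_eq_mul, star_trivial] at *
  have hi : 0 < ‖v‖⁻¹ := inv_pos.mpr hn
  exact (mul_pos_iff_of_pos_left hi).mp ((mul_pos_iff_of_pos_left hi).mp this)

end stab

/-! ### Lyapunov's theorem, existence part -/

open Filter Topology in
lemma tendsto_pow_zero_of_spectralRadius {R : Type*} [NormedRing R] [NormedAlgebra ℂ R]
    [CompleteSpace R] (a : R) (h : spectralRadius ℂ a < 1) :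
    Tendsto (fun n : ℕ => a ^ n) atTop (𝓝 0) := by
  obtain ⟨r, hr1, hr2⟩ := exists_between h
  have h1 := spectrum.pow_nnnorm_pow_one_div_tendsto_nhds_spectralRadius a
  have h2 := h1.eventually (gt_mem_nhds hr1)
  have h3 : ∀ᶠ n : ℕ in atTop, ((‖a ^ n‖₊ : ENNReal)) ≤ r ^ n := by
    filter_upwards [h2, eventually_gt_atTop 0] with n hn hn0
    have hn' : (n : ℝ) ≠ 0 := by positivity
    have := ENNReal.rpow_le_rpow hn.le (by positivity : (0:ℝ) ≤ n)
    rwa [← ENNReal.rpow_mul, one_div, inv_mul_cancel₀ hn', ENNReal.rpow_one,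
      ENNReal.rpow_natCast] at this
  have h4 : Tendsto (fun n : ℕ => ((‖a ^ n‖₊ : ENNReal))) atTop (𝓝 0) :=
    tendsto_of_tendsto_of_tendsto_of_le_of_le' tendsto_const_nhds
      (ENNReal.tendsto_pow_atTop_nhds_zero_of_lt_one hr2) (Eventually.of_forall fun _ => zero_le)
      h3
  have h5 : Tendsto (fun n : ℕ => ‖a ^ n‖₊) atTop (𝓝 0) := by
    exact ENNReal.tendsto_coe.mp (by simpa using h4)
  rw [tendsto_zero_iff_norm_tendsto_zero]
  simpa using NNReal.tendsto_coe.mpr h5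

section lyap
variable {k : Type*} [Fintype k] [DecidableEq k]

open Filter Topology in
lemma matrix_tendsto_pow_zero [Nonempty k] (W : Matrix k k ℝ)
    (h : ∀ μ ∈ spectrum ℂ (W.map (algebraMap ℝ ℂ)), ‖μ‖ < 1) (i j : k) :
    Tendsto (fun n : ℕ => (W ^ n) i j) atTop (𝓝 0) := by
  letI : NormedRing (Matrix k k ℂ) := Matrix.linftyOpNormedRing
  letI : NormedAlgebra ℂ (Matrix k k ℂ) := Matrix.linftyOpNormedAlgebra
  have : CompleteSpace (Matrix k k ℂ) := FiniteDimensional.complete ℂ _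
  have h1 : spectralRadius ℂ (W.map (algebraMap ℝ ℂ)) < 1 := by
    have := spectrum.spectralRadius_lt_of_forall_lt (W.map (algebraMap ℝ ℂ)) (r := 1)
      (fun z hz => by exact_mod_cast h z hz)
    simpa using this
  have h2 := tendsto_pow_zero_of_spectralRadius _ h1
  have h3 : Tendsto (fun n : ℕ => ((W.map (algebraMap ℝ ℂ)) ^ n) i j) atTop (𝓝 0) := by
    have hc : Continuous (fun M : Matrix k k ℂ => M i j) :=
      (LinearMap.continuous_of_finiteDimensional (Matrix.entryLinearMap ℂ ℂ i j))
    have := (hc.tendsto 0).comp h2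
    simpa [Function.comp_def] using this
  have h4 : (fun n : ℕ => ((W.map (algebraMap ℝ ℂ)) ^ n) i j) =
      fun n : ℕ => (((W ^ n) i j : ℝ) : ℂ) := by
    ext n
    have : (W.map (algebraMap ℝ ℂ)) ^ n = (W ^ n).map (algebraMap ℝ ℂ) := by
      exact (map_pow ((algebraMap ℝ ℂ).mapMatrix) W n).symm
    rw [this]; rfl
  rw [h4] at h3
  have := (Complex.continuous_re.tendsto 0).comp h3
  simpa [Function.comp_def] using this

open Filter Topology in
lemma lyap_exists [Nonempty k] {M : Matrix k k ℝ} (hM : IsStableMatrix M) :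
    ∃ P : Matrix k k ℝ, P.PosDef ∧ (-(M * P + P * Mᵀ)).PosDef := by
  have hU : IsUnit (1 - M).det := by
    rw [isUnit_iff_ne_zero]
    intro h0
    obtain ⟨v, hv, h⟩ := Matrix.exists_mulVec_eq_zero_iff.mpr h0
    rw [Matrix.sub_mulVec, Matrix.one_mulVec, sub_eq_zero] at h
    have := (stable_iff_vec M).mp hM 1 (fun i => (v i : ℂ)) ?_ ?_
    · norm_num at this
    · intro h1
      apply hv
      ext i
      simpa using congrFun h1 i
    · ext i
      have := congrArg (fun x : ℝ => (x : ℂ)) (congrFun h i)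
      simp [Matrix.mulVec, dotProduct] at this ⊢
      exact this.symm
  set W : Matrix k k ℝ := (1 - M)⁻¹ * (1 + M) with hW
  have hUW : (1 - M) * W = 1 + M := by
    rw [hW, Matrix.mul_nonsing_inv_cancel_left _ _ hU]
  clear_value W
  have hspec : ∀ μ ∈ spectrum ℂ (W.map (algebraMap ℝ ℂ)), ‖μ‖ < 1 := by
    intro μ hμ
    rw [spectrum.mem_iff, Matrix.isUnit_iff_isUnit_det, isUnit_iff_ne_zero, not_not,
      ← Matrix.exists_mulVec_eq_zero_iff] at hμ
    obtain ⟨v, hv, h⟩ := hμ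
    rw [Matrix.sub_mulVec, sub_eq_zero, Algebra.algebraMap_eq_smul_one, Matrix.smul_mulVec,
      Matrix.one_mulVec] at h
    have hUW' : (1 - M.map (algebraMap ℝ ℂ)) * W.map (algebraMap ℝ ℂ) =
        1 + M.map (algebraMap ℝ ℂ) := by
      have := congrArg ((algebraMap ℝ ℂ).mapMatrix (m := k)) hUW
      simpa only [map_mul, map_sub, map_add, map_one, RingHom.mapMatrix_apply] using this
    have h1 : (1 + M.map (algebraMap ℝ ℂ)) *ᵥ v =
        (1 - M.map (algebraMap ℝ ℂ)) *ᵥ (μ • v) := by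
      rw [← hUW', ← Matrix.mulVec_mulVec, h]
    rw [Matrix.add_mulVec, Matrix.sub_mulVec, Matrix.one_mulVec, Matrix.one_mulVec,
      Matrix.mulVec_smul] at h1
    have h2 : (1 + μ) • ((M.map (algebraMap ℝ ℂ)) *ᵥ v) = (μ - 1) • v := by
      rw [add_smul, sub_smul, one_smul, one_smul]
      linear_combination (exp := 1) h1
    have hne : 1 + μ ≠ 0 := by
      intro h0
      rw [h0, zero_smul] at h2
      have : μ - 1 = 0 := by
        rcases smul_eq_zero.mp h2.symm with h | h
        · exact h
        · exact absurd h hv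
      have : (2:ℂ) = 0 := by linear_combination h0 - this
      norm_num at this
    have h3 : (M.map (algebraMap ℝ ℂ)) *ᵥ v = ((μ - 1) / (1 + μ)) • v := by
      rw [div_eq_inv_mul, mul_smul, ← h2, smul_smul, inv_mul_cancel₀ hne, one_smul]
    have h4 := (stable_iff_vec M).mp hM _ v hv h3
    have h5 : 0 < Complex.normSq (1 + μ) := Complex.normSq_pos.mpr hne
    rw [Complex.div_re, ← add_div, div_neg_iff] at h4
    have h6 : (μ - 1).re * (1 + μ).re + (μ - 1).im * (1 + μ).im < 0 := by
      rcases h4 with h4 | h4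
      · linarith
      · exact h4.1
    simp at h6
    have h7 : ‖μ‖ ^ 2 < 1 := by
      rw [← Complex.normSq_eq_norm_sq, Complex.normSq_apply]
      nlinarith
    nlinarith [norm_nonneg μ]
  have ht : Tendsto (fun n : ℕ => (1 : Matrix k k ℝ) - W ^ n * (W ^ n)ᵀ) atTop (𝓝 1) := by
    have h0 : Tendsto (fun n : ℕ => W ^ n) atTop (𝓝 0) := by
      refine tendsto_pi_nhds.mpr fun i => tendsto_pi_nhds.mpr fun j => ?_
      exact matrix_tendsto_pow_zero W hspec i j
    have hc : Continuous (fun V : Matrix k k ℝ => (1 : Matrix k k ℝ) - V * Vᵀ) := by fun_prop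
    have := (hc.tendsto 0).comp h0
    simpa [Function.comp_def] using this
  have hev := posDef_eventually _ Matrix.PosDef.one ht (fun n => by
    simp [Matrix.IsHermitian, Matrix.conjTranspose_eq_transpose_of_trivial])
  obtain ⟨N, hN1, hN⟩ := (hev.and (eventually_gt_atTop 0)).exists
  set P : Matrix k k ℝ := ∑ i ∈ Finset.range N, W ^ i * (W ^ i)ᵀ with hPdef
  have hPP : P.PosDef := by
    obtain ⟨N', rfl⟩ : ∃ N', N = N' + 1 := ⟨N - 1, by omega⟩
    rw [hPdef, Finset.sum_range_succ']
    refine Matrix.PosDef.posSemidef_add ?_ (by simpa using Matrix.PosDef.one)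
    refine Matrix.posSemidef_sum _ fun i _ => ?_
    simpa [Matrix.conjTranspose_eq_transpose_of_trivial] using
      Matrix.posSemidef_self_mul_conjTranspose (W ^ (i + 1))
  have hstein : P - W * P * Wᵀ = 1 - W ^ N * (W ^ N)ᵀ := by
    have e : W * P * Wᵀ = ∑ i ∈ Finset.range N, W ^ (i + 1) * (W ^ (i + 1))ᵀ := by
      rw [hPdef, Finset.mul_sum, Finset.sum_mul]
      refine Finset.sum_congr rfl fun i _ => ?_
      rw [pow_succ', Matrix.transpose_mul]
      simp only [Matrix.mul_assoc]
    rw [e, hPdef, ← Finset.sum_sub_distrib, Finset.sum_range_sub']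
    simp
  refine ⟨P, hPP, ?_⟩
  have e : -(M * P + P * Mᵀ) =
      (1/2 : ℝ) • ((1 - M) * (1 - W ^ N * (W ^ N)ᵀ) * (1 - M)ᵀ) := by
    rw [← hstein, mul_sub, sub_mul]
    have : (1 - M) * (W * P * Wᵀ) * (1 - M)ᵀ = (1 + M) * P * (1 + M)ᵀ := by
      rw [← hUW, Matrix.transpose_mul]
      simp only [Matrix.mul_assoc]
    rw [this]
    simp only [Matrix.transpose_sub, Matrix.transpose_add, Matrix.transpose_one, sub_mul, mul_sub,
      add_mul, mul_add, one_mul, mul_one]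
    module
  rw [e]
  refine Matrix.PosDef.smul ?_ (by norm_num)
  have := hN1.mul_mul_conjTranspose_same (B := 1 - M)
    (Matrix.vecMul_injective_of_isUnit ((Matrix.isUnit_iff_isUnit_det _).mpr hU))
  rwa [Matrix.conjTranspose_eq_transpose_of_trivial] at this

end lyap

/-! ### Similarity action and the convex parametrization -/

section param
variable {n m p : ℕ}

/-- Triples of controller matrices of order `q`. -/
abbrev Ctl (m p q : ℕ) : Type :=
  Matrix (Fin q) (Fin q) ℝ × Matrix (Fin q) (Fin p) ℝ × Matrix (Fin m) (Fin q) ℝ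

/-- Similarity transformation of a controller. -/
def act {q : ℕ} (g : Matrix (Fin q) (Fin q) ℝ) (K : Ctl m p q) : Ctl m p q :=
  (g * K.1 * g⁻¹, g * K.2.1, K.2.2 * g⁻¹)

lemma act_one {q : ℕ} (K : Ctl m p q) : act 1 K = K := by
  simp [act]

lemma act_mul {q : ℕ} (g h : Matrix (Fin q) (Fin q) ℝ) (K : Ctl m p q) :
    act (g * h) K = act g (act h K) := by
  simp [act, Matrix.mul_inv_rev, Matrix.mul_assoc]

lemma act_mem {q : ℕ} {A : Matrix (Fin n) (Fin n) ℝ} {B : Matrix (Fin n) (Fin m) ℝ}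
    {C : Matrix (Fin p) (Fin n) ℝ} {g : Matrix (Fin q) (Fin q) ℝ} (hg : g.det ≠ 0)
    {K : Ctl m p q} (hK : K ∈ Cset A B C q) : act g K ∈ Cset A B C q := by
  have hu : IsUnit g.det := isUnit_iff_ne_zero.mpr hg
  refine stable_of_intertwine (fromBlocks 1 0 0 g⁻¹) (fromBlocks 1 0 0 g) ?_ ?_ hK
  · simp [fromBlocks_multiply, Matrix.mul_nonsing_inv _ hu]
  · simp [fromBlocks_multiply, act, Matrix.mul_assoc, Matrix.nonsing_inv_mul_cancel_left _ _ hu]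

lemma continuousOn_matrix_inv {k : Type*} [Fintype k] [DecidableEq k] :
    ContinuousOn (fun M : Matrix k k ℝ => M⁻¹) {M | M.det ≠ 0} := by
  have e : (fun M : Matrix k k ℝ => M⁻¹) = fun M => (M.det)⁻¹ • M.adjugate := by
    ext1 M
    rw [Matrix.inv_def, Ring.inverse_eq_inv']
  rw [e]
  refine ContinuousOn.smul (ContinuousOn.inv₀ ?_ fun M hM => hM) ?_
  · exact (continuous_id.matrix_det).continuousOn
  · exact (continuous_id.matrix_adjugate).continuousOn

lemma continuousOn_matrix_mul {T i j k : Type*} [TopologicalSpace T] [Fintype j]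
    {s : Set T} {f : T → Matrix i j ℝ} {g : T → Matrix j k ℝ} (hf : ContinuousOn f s)
    (hg : ContinuousOn g s) : ContinuousOn (fun t => f t * g t) s :=
  (continuous_fst.matrix_mul continuous_snd).comp_continuousOn (hf.prodMk hg)

lemma joined_act {q : ℕ} {A : Matrix (Fin n) (Fin n) ℝ} {B : Matrix (Fin n) (Fin m) ℝ}
    {C : Matrix (Fin p) (Fin n) ℝ} {g h : Matrix (Fin q) (Fin q) ℝ}
    (hgh : JoinedIn {M : Matrix (Fin q) (Fin q) ℝ | M.det ≠ 0} g h)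
    {K : Ctl m p q} (hK : K ∈ Cset A B C q) :
    JoinedIn (Cset A B C q) (act g K) (act h K) := by
  have hc : ContinuousOn (fun g : Matrix (Fin q) (Fin q) ℝ => act g K) {M | M.det ≠ 0} := by
    have hi := continuousOn_matrix_inv (k := Fin q)
    refine ContinuousOn.prodMk ?_ (ContinuousOn.prodMk ?_ ?_)
    · exact continuousOn_matrix_mul (by fun_prop) hi
    · fun_prop
    · exact continuousOn_matrix_mul (by fun_prop) hi
  refine (hgh.map_continuousOn hc).mono ?_
  rintro _ ⟨g, hg, rfl⟩
  exact act_mem hg hK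

/-- Parameters `(X, Y, M, H, F)` of the linear-matrix-inequality description. -/
abbrev Par (n m p : ℕ) : Type :=
  Matrix (Fin n) (Fin n) ℝ × Matrix (Fin n) (Fin n) ℝ × Matrix (Fin n) (Fin n) ℝ ×
    Matrix (Fin n) (Fin p) ℝ × Matrix (Fin m) (Fin n) ℝ

/-- The block matrix `[[X, 1], [1, Y]]`. -/
def parN (u : Par n m p) : Matrix (Fin n ⊕ Fin n) (Fin n ⊕ Fin n) ℝ :=
  fromBlocks u.1 1 1 u.2.1

/-- The block matrix `[[A X + B F, A], [M, Y A + H C]]`. -/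
def parL (A : Matrix (Fin n) (Fin n) ℝ) (B : Matrix (Fin n) (Fin m) ℝ)
    (C : Matrix (Fin p) (Fin n) ℝ) (u : Par n m p) :
    Matrix (Fin n ⊕ Fin n) (Fin n ⊕ Fin n) ℝ :=
  fromBlocks (A * u.1 + B * u.2.2.2.2) A u.2.2.1 (u.2.1 * A + u.2.2.2.1 * C)

/-- The convex set of parameters. -/
def parSet (A : Matrix (Fin n) (Fin n) ℝ) (B : Matrix (Fin n) (Fin m) ℝ)
    (C : Matrix (Fin p) (Fin n) ℝ) : Set (Par n m p) :=
  {u | (parN u).PosDef ∧ (-(parL A B C u + (parL A B C u)ᵀ)).PosDef}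

/-- Controller reconstructed from parameters. -/
def parCtl (A : Matrix (Fin n) (Fin n) ℝ) (B : Matrix (Fin n) (Fin m) ℝ)
    (C : Matrix (Fin p) (Fin n) ℝ) (u : Par n m p) : Ctl m p n :=
  ((1 - u.2.1 * u.1)⁻¹ *
      (u.2.2.1 - u.2.1 * (A * u.1 + B * u.2.2.2.2) - u.2.2.2.1 * C * u.1),
    (1 - u.2.1 * u.1)⁻¹ * u.2.2.2.1, u.2.2.2.2)

lemma posDef_combo {k : Type*} [Fintype k] [DecidableEq k] {P Q : Matrix k k ℝ} (hP : P.PosDef)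
    (hQ : Q.PosDef) {a b : ℝ} (ha : 0 ≤ a) (hb : 0 ≤ b) (hab : a + b = 1) :
    (a • P + b • Q).PosDef := by
  rcases eq_or_lt_of_le ha with h | h
  · subst h
    have : b = 1 := by linarith
    subst this
    simpa using hQ
  · exact (hP.smul h).add_posSemidef (hQ.posSemidef.smul hb)

lemma parSet_convex (A : Matrix (Fin n) (Fin n) ℝ) (B : Matrix (Fin n) (Fin m) ℝ)
    (C : Matrix (Fin p) (Fin n) ℝ) : Convex ℝ (parSet A B C) := by
  intro u hu v hv a b ha hb hab
  have e1 : parN (a • u + b • v) = a • parN u + b • parN v := by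
    simp only [parN, fromBlocks_smul, fromBlocks_add, Prod.fst_add, Prod.snd_add, Prod.smul_fst,
      Prod.smul_snd, ← add_smul, hab, one_smul]
  have e2 : parL A B C (a • u + b • v) = a • parL A B C u + b • parL A B C v := by
    simp only [parL, fromBlocks_smul, fromBlocks_add, Prod.fst_add, Prod.snd_add, Prod.smul_fst,
      Prod.smul_snd, ← add_smul, hab, one_smul]
    congr 1
    · simp only [Matrix.mul_add, Matrix.mul_smul, smul_add]; abel
    · simp only [Matrix.add_mul, Matrix.smul_mul, smul_add]; abel
  refine ⟨?_, ?_⟩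
  · rw [e1]
    exact posDef_combo hu.1 hv.1 ha hb hab
  · rw [e2]
    have : -(a • parL A B C u + b • parL A B C v + (a • parL A B C u + b • parL A B C v)ᵀ) =
        a • (-(parL A B C u + (parL A B C u)ᵀ)) + b • (-(parL A B C v + (parL A B C v)ᵀ)) := by
      simp only [Matrix.transpose_add, Matrix.transpose_smul]
      module
    rw [this]
    exact posDef_combo hu.2 hv.2 ha hb hab

lemma par_det {u : Par n m p} (hu : (parN u).PosDef) : (1 - u.2.1 * u.1).det ≠ 0 := by
  have e : fromBlocks 1 0 u.2.1 (1 - u.2.1 * u.1) * fromBlocks u.1 1 1 0 = parN u := by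
    simp [fromBlocks_multiply, parN]
  have h := (Matrix.isUnit_iff_isUnit_det _).mp hu.isUnit
  rw [← e, Matrix.det_mul, Matrix.det_fromBlocks_zero₁₂] at h
  intro h0
  rw [h0] at h
  simp at h

lemma parCtl_continuousOn (A : Matrix (Fin n) (Fin n) ℝ) (B : Matrix (Fin n) (Fin m) ℝ)
    (C : Matrix (Fin p) (Fin n) ℝ) : ContinuousOn (parCtl A B C) (parSet A B C) := by
  have hi : ContinuousOn (fun u : Par n m p => (1 - u.2.1 * u.1)⁻¹) (parSet A B C) := by
    refine ContinuousOn.comp (continuousOn_matrix_inv (k := Fin n))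
      (f := fun u : Par n m p => 1 - u.2.1 * u.1) ?_ ?_
    · exact (continuous_const.sub
        (continuous_snd.fst.matrix_mul continuous_fst)).continuousOn
    · intro u hu
      exact par_det hu.1
  refine ContinuousOn.prodMk ?_ (ContinuousOn.prodMk ?_ ?_)
  · refine continuousOn_matrix_mul hi ?_
    fun_prop
  · refine continuousOn_matrix_mul hi ?_
    fun_prop
  · fun_prop

lemma stable_of_congruence {k : Type*} [Fintype k] [DecidableEq k] {S R M N L : Matrix k k ℝ}
    (hS : IsUnit S) (hN : S * R = N) (hL : S * M * R = L) (hNp : N.PosDef)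
    (hLp : (-(L + Lᵀ)).PosDef) : IsStableMatrix M := by
  have hSd : IsUnit S.det := (Matrix.isUnit_iff_isUnit_det _).mp hS
  have hSi : IsUnit S⁻¹ := by
    rw [Matrix.isUnit_iff_isUnit_det, Matrix.det_nonsing_inv]
    simpa using hSd
  have hR : R = S⁻¹ * N := by
    rw [← hN, Matrix.nonsing_inv_mul_cancel_left _ _ hSd]
  have hinj := Matrix.vecMul_injective_of_isUnit hSi
  have hP := hNp.mul_mul_conjTranspose_same hinj
  have hQ := hLp.mul_mul_conjTranspose_same hinj
  rw [Matrix.conjTranspose_eq_transpose_of_trivial] at hP hQ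
  refine stable_of_lyap hP ?_
  have hNs : Nᵀ = N := by simpa [Matrix.IsHermitian] using hNp.1
  have e1 : M * (S⁻¹ * N * S⁻¹ᵀ) = S⁻¹ * L * S⁻¹ᵀ := by
    rw [← hL, ← hR]
    simp only [Matrix.mul_assoc]
    rw [Matrix.nonsing_inv_mul_cancel_left _ _ hSd]
  have e2 : (S⁻¹ * N * S⁻¹ᵀ) * Mᵀ = S⁻¹ * Lᵀ * S⁻¹ᵀ := by
    have := congrArg Matrix.transpose e1
    simpa [Matrix.transpose_mul, hNs, Matrix.mul_assoc] using this
  rw [e1, e2]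
  convert hQ using 1
  simp only [Matrix.mul_neg, Matrix.neg_mul, Matrix.mul_add, Matrix.add_mul]

lemma parCtl_mem {A : Matrix (Fin n) (Fin n) ℝ} {B : Matrix (Fin n) (Fin m) ℝ}
    {C : Matrix (Fin p) (Fin n) ℝ} {u : Par n m p} (hu : u ∈ parSet A B C) :
    parCtl A B C u ∈ Cset A B C n := by
  have hd : IsUnit (1 - u.2.1 * u.1).det := isUnit_iff_ne_zero.mpr (par_det hu.1)
  refine stable_of_congruence (S := fromBlocks 1 0 u.2.1 (1 - u.2.1 * u.1))
    (R := fromBlocks u.1 1 1 0) (N := parN u) (L := parL A B C u) ?_ ?_ ?_ hu.1 hu.2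
  · rw [Matrix.isUnit_iff_isUnit_det, Matrix.det_fromBlocks_zero₁₂]
    simpa using hd
  · simp [fromBlocks_multiply, parN]
  · simp only [fromBlocks_multiply, parL, parCtl, Matrix.one_mul, Matrix.zero_mul, Matrix.mul_one,
      Matrix.mul_zero, add_zero, zero_add]
    have e : ∀ {l : Type} (Z : Matrix (Fin n) l ℝ),
      (1 - u.2.1 * u.1) * ((1 - u.2.1 * u.1)⁻¹ * Z) = Z :=
      fun Z => Matrix.mul_nonsing_inv_cancel_left _ _ hd
    congr 1
    · simp only [Matrix.add_mul, Matrix.mul_assoc, e, Matrix.mul_add]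
      abel
    · simp only [Matrix.mul_assoc, e]

end param

section surj
variable {n m p : ℕ}

/-- The Lyapunov matrix can be chosen with invertible off-diagonal block. -/
lemma lyap_exists_offdiag {M : Matrix (Fin n ⊕ Fin n) (Fin n ⊕ Fin n) ℝ} (hn : 1 ≤ n)
    (hM : IsStableMatrix M) :
    ∃ P : Matrix (Fin n ⊕ Fin n) (Fin n ⊕ Fin n) ℝ, P.PosDef ∧ (-(M * P + P * Mᵀ)).PosDef ∧
      P.toBlocks₂₁.det ≠ 0 := by
  have : Nonempty (Fin n ⊕ Fin n) := ⟨Sum.inl ⟨0, hn⟩⟩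
  obtain ⟨P, hP, hL⟩ := lyap_exists hM
  have hPs : Pᵀ = P := by simpa [Matrix.IsHermitian] using hP.1
  set D : Matrix (Fin n ⊕ Fin n) (Fin n ⊕ Fin n) ℝ := fromBlocks 0 1 1 0 with hD
  have hDs : Dᵀ = D := by simp [hD, fromBlocks_transpose]
  have hEs : ∀ t : ℝ, (P + t • D)ᵀ = P + t • D := by
    intro t; rw [Matrix.transpose_add, Matrix.transpose_smul, hPs, hDs]
  have c1 : Continuous (fun t : ℝ => P + t • D) := by fun_prop
  have c2 : Continuous (fun t : ℝ => -(M * (P + t • D) + (P + t • D) * Mᵀ)) := by fun_prop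
  have ev1 : ∀ᶠ t in nhds (0 : ℝ), (P + t • D).PosDef := by
    refine posDef_eventually _ hP ?_ ?_
    · simpa using c1.tendsto 0
    · intro t
      rw [Matrix.IsHermitian, Matrix.conjTranspose_eq_transpose_of_trivial, hEs]
  have ev2 : ∀ᶠ t in nhds (0 : ℝ), (-(M * (P + t • D) + (P + t • D) * Mᵀ)).PosDef := by
    refine posDef_eventually _ hL ?_ ?_
    · simpa using c2.tendsto 0
    · intro t
      rw [Matrix.IsHermitian, Matrix.conjTranspose_eq_transpose_of_trivial, Matrix.transpose_neg,
        Matrix.transpose_add, Matrix.transpose_mul, Matrix.transpose_mul, hEs,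
        Matrix.transpose_transpose, add_comm]
  have hinf := infinite_of_mem_nhds (0 : ℝ) (ev1.and ev2)
  obtain ⟨t, ht, hroot⟩ := hinf.exists_notMem_finset ((-P.toBlocks₂₁).charpoly.roots.toFinset)
  refine ⟨P + t • D, ht.1, ht.2, ?_⟩
  intro h0
  apply hroot
  rw [Multiset.mem_toFinset, Polynomial.mem_roots (Matrix.charpoly_monic _).ne_zero,
    Polynomial.IsRoot, Matrix.eval_charpoly]
  rw [← h0]
  congr 1
  ext i j
  simp [hD, toBlocks₂₁, Matrix.one_apply, Matrix.diagonal_apply]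
  split_ifs <;> ring

lemma exists_par {A : Matrix (Fin n) (Fin n) ℝ} {B : Matrix (Fin n) (Fin m) ℝ}
    {C : Matrix (Fin p) (Fin n) ℝ} (hn : 1 ≤ n) {K : Ctl m p n} (hK : K ∈ Cset A B C n) :
    ∃ g : Matrix (Fin n) (Fin n) ℝ, g.det ≠ 0 ∧ ∃ u ∈ parSet A B C, K = act g (parCtl A B C u) := by
  obtain ⟨P, hP, hL, hdet⟩ := lyap_exists_offdiag hn hK
  have hPs : Pᵀ = P := by simpa [Matrix.IsHermitian] using hP.1
  have hPi := hP.inv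
  have hPis : (P⁻¹)ᵀ = P⁻¹ := by simpa [Matrix.IsHermitian] using hPi.1
  obtain ⟨X, Pi', Pi, Z, rfl⟩ : ∃ a b c d, P = fromBlocks a b c d :=
    ⟨_, _, _, _, (fromBlocks_toBlocks P).symm⟩
  rw [toBlocks_fromBlocks₂₁] at hdet
  have hPu : IsUnit (fromBlocks X Pi' Pi Z).det := (Matrix.isUnit_iff_isUnit_det _).mp hP.isUnit
  have hinv := Matrix.mul_nonsing_inv _ hPu
  obtain ⟨Y, Xi, Xi', Z', hY⟩ : ∃ a b c d, (fromBlocks X Pi' Pi Z)⁻¹ = fromBlocks a b c d :=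
    ⟨_, _, _, _, (fromBlocks_toBlocks _).symm⟩
  rw [hY] at hinv hPis
  rw [fromBlocks_transpose, fromBlocks_inj] at hPs hPis
  obtain ⟨hXs, hPi1, hPi2, hZs⟩ := hPs
  obtain ⟨hYs, hXi1, hXi2, hZs'⟩ := hPis
  rw [fromBlocks_multiply, ← fromBlocks_one, fromBlocks_inj] at hinv
  obtain ⟨h11, -, h21, -⟩ := hinv
  have hPiu : IsUnit Pi.det := isUnit_iff_ne_zero.mpr hdet
  -- `Y X + Ξ Π = 1`
  have hYX : Y * X + Xi * Pi = 1 := by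
    have := congrArg Matrix.transpose h11
    rw [Matrix.transpose_add, Matrix.transpose_mul, Matrix.transpose_mul, Matrix.transpose_one,
      hYs, hXs, hXi1, hPi2] at this
    exact this
  set S : Matrix (Fin n ⊕ Fin n) (Fin n ⊕ Fin n) ℝ := fromBlocks 1 0 Y Xi with hS
  set R : Matrix (Fin n ⊕ Fin n) (Fin n ⊕ Fin n) ℝ := fromBlocks X 1 Pi 0 with hR
  have hPS : fromBlocks X Pi' Pi Z * Sᵀ = R := by
    rw [hS, hR, fromBlocks_transpose, fromBlocks_multiply, hYs, hXi2]
    simp [h11, h21]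
  have hRu : IsUnit R := by
    have : R * (fromBlocks 0 Pi⁻¹ 1 (-(X * Pi⁻¹)) : Matrix (Fin n ⊕ Fin n) (Fin n ⊕ Fin n) ℝ) = 1 := by
      rw [hR, fromBlocks_multiply, ← fromBlocks_one]
      simp [Matrix.mul_nonsing_inv _ hPiu]
    exact IsUnit.of_mul_eq_one _ this
  have hSd : S.det ≠ 0 := by
    have h := (Matrix.isUnit_iff_isUnit_det _).mp hRu
    rw [← hPS, Matrix.det_mul, Matrix.det_transpose] at h
    intro h0
    rw [h0] at h
    simp at h
  have hSu : IsUnit S := (Matrix.isUnit_iff_isUnit_det _).mpr (isUnit_iff_ne_zero.mpr hSd)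
  have hXid : Xi.det ≠ 0 := by
    rw [hS, Matrix.det_fromBlocks_zero₁₂] at hSd
    simpa using hSd
  have hXiu : IsUnit Xi.det := isUnit_iff_ne_zero.mpr hXid
  set u : Par n m p := (X, Y, Y * (A * X + B * (K.2.2 * Pi)) + Xi * K.2.1 * C * X +
    Xi * K.1 * Pi, Xi * K.2.1, K.2.2 * Pi) with hu
  have hN : S * fromBlocks X Pi' Pi Z * Sᵀ = parN u := by
    rw [Matrix.mul_assoc, hPS, hS, hR, fromBlocks_multiply, parN]
    simp [hYX, hu]
  have hLe : S * fromBlocks A (B * K.2.2) (K.2.1 * C) K.1 * R = parL A B C u := by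
    rw [hS, hR, fromBlocks_multiply, fromBlocks_multiply, parL, hu]
    simp only [Matrix.one_mul, Matrix.zero_mul, Matrix.mul_one, Matrix.mul_zero, add_zero,
      Matrix.add_mul, Matrix.mul_add, Matrix.mul_assoc]
    congr 1
    abel
  have hinj := Matrix.vecMul_injective_of_isUnit hSu
  have hmem : u ∈ parSet A B C := by
    constructor
    · have := hP.mul_mul_conjTranspose_same hinj
      rwa [Matrix.conjTranspose_eq_transpose_of_trivial, hN] at this
    · have := hL.mul_mul_conjTranspose_same hinj
      rw [Matrix.conjTranspose_eq_transpose_of_trivial] at this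
      convert this using 1
      have e1 : S * (fromBlocks A (B * K.2.2) (K.2.1 * C) K.1 * fromBlocks X Pi' Pi Z) * Sᵀ =
          parL A B C u := by
        rw [← hLe, ← hPS]
        simp only [Matrix.mul_assoc]
      have e2 : S * (fromBlocks X Pi' Pi Z * (fromBlocks A (B * K.2.2) (K.2.1 * C) K.1)ᵀ) * Sᵀ =
          (parL A B C u)ᵀ := by
        rw [← e1]
        simp only [Matrix.transpose_mul, Matrix.mul_assoc, Matrix.transpose_transpose]
        rw [show (fromBlocks X Pi' Pi Z)ᵀ = fromBlocks X Pi' Pi Z by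
          rw [fromBlocks_transpose, hXs, hPi1, hPi2, hZs]]
      rw [Matrix.mul_neg, Matrix.neg_mul, Matrix.mul_add, Matrix.add_mul, e1, e2]
  refine ⟨Pi, hdet, u, hmem, ?_⟩
  have hXiPi : 1 - Y * X = Xi * Pi := by rw [← hYX]; abel
  have hc : parCtl A B C u = act Pi⁻¹ K := by
    rw [parCtl, act, hu]
    simp only [hXiPi, Matrix.mul_inv_rev, Matrix.nonsing_inv_nonsing_inv _ hPiu]
    refine Prod.ext ?_ (Prod.ext ?_ rfl)
    · have : Y * (A * X + B * (K.2.2 * Pi)) + Xi * K.2.1 * C * X + Xi * K.1 * Pi -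
          Y * (A * X + B * (K.2.2 * Pi)) - Xi * K.2.1 * C * X = Xi * (K.1 * Pi) := by
        rw [← Matrix.mul_assoc Xi K.1 Pi]; abel
      rw [this]
      simp only [Matrix.mul_assoc, Matrix.nonsing_inv_mul_cancel_left _ _ hXiu]
    · simp only [Matrix.mul_assoc, Matrix.nonsing_inv_mul_cancel_left _ _ hXiu]
  rw [hc, ← act_mul, Matrix.mul_nonsing_inv _ hPiu, act_one]

/-- If some stabilizing controller is invariant under a reflection, `𝒞_n` is path-connected. -/
lemma pathConnected_of_refl {A : Matrix (Fin n) (Fin n) ℝ} {B : Matrix (Fin n) (Fin m) ℝ}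
    {C : Matrix (Fin p) (Fin n) ℝ} (hn : 1 ≤ n) (i₀ : Fin n) {K₀ : Ctl m p n}
    (hK₀ : K₀ ∈ Cset A B C n) (hfix : act (reflMat i₀) K₀ = K₀) :
    IsPathConnected (Cset A B C n) := by
  obtain ⟨g₀, hg₀, u₀, hu₀, e₀⟩ := exists_par hn hK₀
  -- joining `parCtl u` for all `u`
  have hpar : ∀ u ∈ parSet A B C, JoinedIn (Cset A B C n) (parCtl A B C u₀) (parCtl A B C u) := by
    intro u hu
    have hpc : IsPathConnected (parSet A B C) := (parSet_convex A B C).isPathConnected ⟨u₀, hu₀⟩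
    refine ((hpc.joinedIn u₀ hu₀ u hu).map_continuousOn (parCtl_continuousOn A B C)).mono ?_
    rintro _ ⟨v, hv, rfl⟩
    exact parCtl_mem hv
  have hcact : ∀ (g : Matrix (Fin n) (Fin n) ℝ), g.det ≠ 0 → ∀ K K' : Ctl m p n,
      JoinedIn (Cset A B C n) K K' → JoinedIn (Cset A B C n) (act g K) (act g K') := by
    intro g hg K K' h
    have hc : Continuous (fun K : Ctl m p n => act g K) := by
      unfold act
      fun_prop
    refine (h.map hc).mono ?_
    rintro _ ⟨L, hL, rfl⟩
    exact act_mem hg hL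
  refine ⟨K₀, hK₀, fun {K} hK => ?_⟩
  obtain ⟨g, hg, u, hu, e⟩ := exists_par hn hK
  -- `K` is joined to `act h K₀` with `h = g g₀⁻¹`
  have hg₀u : IsUnit g₀.det := isUnit_iff_ne_zero.mpr hg₀
  have e₁ : parCtl A B C u₀ = act g₀⁻¹ K₀ := by
    rw [e₀, ← act_mul, Matrix.nonsing_inv_mul _ hg₀u, act_one]
  have j1 : JoinedIn (Cset A B C n) (act (g * g₀⁻¹) K₀) K := by
    rw [act_mul, ← e₁, e]
    exact hcact g hg _ _ (hpar u hu)
  have hdet : (g * g₀⁻¹).det ≠ 0 := by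
    rw [Matrix.det_mul, Matrix.det_nonsing_inv]
    simp [hg, hg₀]
  rcases joined_GL i₀ _ hdet with h | h
  · have := joined_act (m := m) (p := p) h hK₀
    rw [act_one] at this
    exact this.trans j1
  · have := joined_act (m := m) (p := p) h hK₀
    rw [hfix] at this
    exact this.trans j1

end surj

section augment
variable {n m p : ℕ}

/-- Augment a controller by one stable decoupled state. -/
def augCtl {q : ℕ} (K : Ctl m p q) : Ctl m p (q + 1) :=
  ((fromBlocks K.1 0 0 (-1 : Matrix (Fin 1) (Fin 1) ℝ)).submatrix
      finSumFinEquiv.symm finSumFinEquiv.symm,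
   (fromRows K.2.1 (0 : Matrix (Fin 1) (Fin p) ℝ)).submatrix finSumFinEquiv.symm id,
   (fromCols K.2.2 (0 : Matrix (Fin m) (Fin 1) ℝ)).submatrix id finSumFinEquiv.symm)

lemma augCtl_mem {A : Matrix (Fin n) (Fin n) ℝ} {B : Matrix (Fin n) (Fin m) ℝ}
    {C : Matrix (Fin p) (Fin n) ℝ} {q : ℕ} {K : Ctl m p q} (hK : K ∈ Cset A B C q) :
    augCtl K ∈ Cset A B C (q + 1) := by
  have h1 : IsStableMatrix (-1 : Matrix (Fin 1) (Fin 1) ℝ) := by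
    refine stable_of_charpoly_eq (M := (-1 : Matrix Unit Unit ℝ)) ?_ stable_neg_one
    simp [Matrix.charpoly, Matrix.charmatrix]
  have h2 := stable_blockdiag hK h1
  let e : (Fin n ⊕ Fin q) ⊕ Fin 1 ≃ Fin n ⊕ Fin (q + 1) :=
    (Equiv.sumAssoc _ _ _).trans (Equiv.sumCongr (Equiv.refl _) finSumFinEquiv)
  have h3 : (fromBlocks A (B * (augCtl K).2.2) ((augCtl K).2.1 * C) (augCtl K).1) =
      Matrix.reindex e e (fromBlocks (fromBlocks A (B * K.2.2) (K.2.1 * C) K.1) 0 0 (-1)) := by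
    rw [← Equiv.symm_apply_eq, Matrix.reindex_symm]
    ext i j
    rcases i with (i | i) | i <;> rcases j with (j | j) | j <;>
      simp [e, augCtl, Matrix.mul_apply, -finSumFinEquiv_apply_left, -finSumFinEquiv_apply_right]
  refine stable_of_charpoly_eq ?_ h2
  change _ = (fromBlocks A (B * (augCtl K).2.2) ((augCtl K).2.1 * C) (augCtl K).1).charpoly
  rw [h3, Matrix.charpoly_reindex]

lemma augCtl_fix {q : ℕ} (K : Ctl m p q) :
    act (reflMat (finSumFinEquiv (Sum.inr (0 : Fin 1)))) (augCtl K) = augCtl K := by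
  have hi : (reflMat (finSumFinEquiv (Sum.inr (0 : Fin 1)) : Fin (q + 1)))⁻¹ =
      reflMat (finSumFinEquiv (Sum.inr (0 : Fin 1))) :=
    Matrix.inv_eq_right_inv (reflMat_mul_self _)
  rw [act, hi]
  refine Prod.ext ?_ (Prod.ext ?_ ?_)
  · ext i j
    obtain ⟨i, rfl⟩ := finSumFinEquiv.surjective i
    obtain ⟨j, rfl⟩ := finSumFinEquiv.surjective j
    rcases i with i | i <;> rcases j with j | j <;>
      simp [reflMat, augCtl, Matrix.mul_diagonal, Matrix.diagonal_mul, Subsingleton.elim _ (0 : Fin 1),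
        -finSumFinEquiv_apply_left, -finSumFinEquiv_apply_right]
  · ext i j
    obtain ⟨i, rfl⟩ := finSumFinEquiv.surjective i
    rcases i with i | i <;>
      simp [reflMat, augCtl, Matrix.mul_diagonal, Matrix.diagonal_mul,
        -finSumFinEquiv_apply_left, -finSumFinEquiv_apply_right]
  · ext i j
    obtain ⟨j, rfl⟩ := finSumFinEquiv.surjective j
    rcases j with j | j <;>
      simp [reflMat, augCtl, Matrix.mul_diagonal, Matrix.diagonal_mul,
        -finSumFinEquiv_apply_left, -finSumFinEquiv_apply_right]

lemma Cset_nonempty_mono {A : Matrix (Fin n) (Fin n) ℝ} {B : Matrix (Fin n) (Fin m) ℝ}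
    {C : Matrix (Fin p) (Fin n) ℝ} {q r : ℕ} (hqr : q ≤ r) (h : (Cset A B C q).Nonempty) :
    (Cset A B C r).Nonempty := by
  induction r, hqr using Nat.le_induction with
  | base => exact h
  | succ r _ ih => exact ⟨_, augCtl_mem ih.some_mem⟩

lemma pathConnected_of_reduced {A : Matrix (Fin n) (Fin n) ℝ} {B : Matrix (Fin n) (Fin m) ℝ}
    {C : Matrix (Fin p) (Fin n) ℝ} (hn : 1 ≤ n) (h : (Cset A B C (n - 1)).Nonempty) :
    IsPathConnected (Cset A B C n) := by
  obtain ⟨q, hq⟩ : ∃ q, q + 1 = n := ⟨n - 1, by omega⟩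
  have h' : (Cset A B C q).Nonempty := by
    have : q = n - 1 := by omega
    rw [this]; exact h
  obtain ⟨K, hK⟩ := h'
  have key : ∃ (i₀ : Fin n) (K₀ : Ctl m p n), K₀ ∈ Cset A B C n ∧ act (reflMat i₀) K₀ = K₀ := by
    have : ∃ (i₀ : Fin (q + 1)) (K₀ : Ctl m p (q + 1)),
        K₀ ∈ Cset A B C (q + 1) ∧ act (reflMat i₀) K₀ = K₀ :=
      ⟨_, _, augCtl_mem hK, augCtl_fix K⟩
    rw [hq] at this
    exact this
  obtain ⟨i₀, K₀, h1, h2⟩ := key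
  exact pathConnected_of_refl hn i₀ h1 h2

end augment

section reduction
variable {n m : ℕ}

/-- Controllability matrix of a single-output controller. -/
def ctrMat {q : ℕ} (K : Ctl m 1 q) : Matrix (Fin q) (Fin q) ℝ :=
  Matrix.of fun i j => (K.1 ^ (j : ℕ) * K.2.1) i 0

lemma ctrMat_act {q : ℕ} (g : Matrix (Fin q) (Fin q) ℝ) (hg : g.det ≠ 0) (K : Ctl m 1 q) :
    ctrMat (act g K) = g * ctrMat K := by
  have hu : IsUnit g.det := isUnit_iff_ne_zero.mpr hg
  have hp : ∀ j : ℕ, (g * K.1 * g⁻¹) ^ j * (g * K.2.1) = g * (K.1 ^ j * K.2.1) := by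
    intro j
    induction j with
    | zero => simp
    | succ j ih =>
      rw [pow_succ', Matrix.mul_assoc, ih, pow_succ']
      simp only [Matrix.mul_assoc, Matrix.nonsing_inv_mul_cancel_left _ _ hu]
  ext i j
  simp only [ctrMat, act, Matrix.of_apply, hp]
  simp [Matrix.mul_apply]

lemma continuous_ctrMat {q : ℕ} : Continuous (fun K : Ctl m 1 q => (ctrMat K).det) := by
  apply Continuous.matrix_det
  apply continuous_matrix
  intro i j
  simp only [ctrMat, Matrix.of_apply]
  have : Continuous (fun K : Ctl m 1 q => K.1 ^ (j : ℕ) * K.2.1) :=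
    (continuous_fst.pow _).matrix_mul continuous_snd.fst
  exact this.matrix_elem i 0

/-- If the controller is uncontrollable, its order can be reduced. -/
lemma reduction {A : Matrix (Fin n) (Fin n) ℝ} {B : Matrix (Fin n) (Fin m) ℝ}
    {C : Matrix (Fin 1) (Fin n) ℝ} {q : ℕ} {K : Ctl m 1 q} (hK : K ∈ Cset A B C q)
    (hdet : (ctrMat K).det = 0) : (Cset A B C (q - 1)).Nonempty := by
  obtain ⟨w, hw0, hw⟩ := Matrix.exists_vecMul_eq_zero_iff.mpr hdet
  set b : Fin q → ℝ := fun i => K.2.1 i 0 with hb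
  -- `w` annihilates every Krylov vector
  have hall : ∀ f : Polynomial ℝ, w ⬝ᵥ ((Polynomial.aeval K.1 f) *ᵥ b) = 0 := by
    intro f
    have hlow : ∀ j < q, w ⬝ᵥ ((K.1 ^ j) *ᵥ b) = 0 := by
      intro j hj
      have := congrFun hw ⟨j, hj⟩
      simpa [Matrix.vecMul, ctrMat, Matrix.mul_apply, dotProduct, Matrix.mulVec, hb] using this
    have hmod : Polynomial.aeval K.1 f = Polynomial.aeval K.1 (f %ₘ K.1.charpoly) :=
      (Matrix.aeval_eq_aeval_mod_charpoly K.1 f)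
    rw [hmod]
    by_cases hq : q = 0
    · subst hq
      simp [dotProduct]
    have hdeg : (f %ₘ K.1.charpoly).natDegree < q := by
      have := Polynomial.natDegree_modByMonic_lt f (Matrix.charpoly_monic K.1) (by
        intro h
        have h2 := Matrix.charpoly_natDegree_eq_dim K.1
        rw [h] at h2
        simp at h2
        omega)
      simpa [Matrix.charpoly_natDegree_eq_dim] using this
    rw [Polynomial.aeval_eq_sum_range' hdeg, Matrix.sum_mulVec, dotProduct_sum]
    refine Finset.sum_eq_zero fun j hj => ?_
    rw [Matrix.smul_mulVec, dotProduct_smul, hlow j (Finset.mem_range.mp hj), smul_zero]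
  -- the Krylov subspace
  let φ : Polynomial ℝ →ₗ[ℝ] (Fin q → ℝ) :=
    { toFun := fun f => (Polynomial.aeval K.1 f) *ᵥ b
      map_add' := fun f g => by simp [Matrix.add_mulVec]
      map_smul' := fun c f => by simp [Matrix.smul_mulVec] }
  set V : Submodule ℝ (Fin q → ℝ) := LinearMap.range φ with hV
  have hVne : V ≠ ⊤ := by
    intro h
    have : w ∈ V := by rw [h]; trivial
    obtain ⟨f, hf⟩ := this
    have h2 := hall f
    change w ⬝ᵥ (φ f) = 0 at h2
    rw [hf] at h2
    exact hw0 (dotProduct_self_eq_zero.mp h2)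
  have hr : Module.finrank ℝ V < q := by
    have := Submodule.finrank_lt hVne
    simpa using this
  set r := Module.finrank ℝ V with hrdef
  let bas : Module.Basis (Fin r) ℝ V := Module.finBasis ℝ V
  let ι : (Fin r → ℝ) →ₗ[ℝ] (Fin q → ℝ) := V.subtype ∘ₗ bas.equivFun.symm.toLinearMap
  have hιinj : LinearMap.ker ι = ⊥ := by
    rw [LinearMap.ker_eq_bot]
    exact V.injective_subtype.comp bas.equivFun.symm.injective
  obtain ⟨π, hπ⟩ := ι.exists_leftInverse_of_injective hιinj
  set E := LinearMap.toMatrix' ι with hE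
  set Q := LinearMap.toMatrix' π with hQ
  have hQE : Q * E = 1 := by
    rw [hQ, hE, ← LinearMap.toMatrix'_comp, hπ, LinearMap.toMatrix'_id]
  have hEV : ∀ x, E *ᵥ x ∈ V := by
    intro x
    rw [hE, LinearMap.toMatrix'_mulVec]
    exact (bas.equivFun.symm x).2
  have hEQ : ∀ v ∈ V, E *ᵥ (Q *ᵥ v) = v := by
    intro v hv
    have hx : v = E *ᵥ (bas.equivFun ⟨v, hv⟩) := by
      rw [hE, LinearMap.toMatrix'_mulVec]
      simp [ι]
    rw [hx, Matrix.mulVec_mulVec, Matrix.mulVec_mulVec, Matrix.mul_assoc E,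
      hQE, Matrix.mul_one]
  have hAV : ∀ v ∈ V, K.1 *ᵥ v ∈ V := by
    rintro _ ⟨f, rfl⟩
    refine ⟨Polynomial.X * f, ?_⟩
    simp [φ, Matrix.mulVec_mulVec]
  have hbV : b ∈ V := ⟨1, by simp [φ]⟩
  have hAE : E * (Q * (K.1 * E)) = K.1 * E := by
    apply Matrix.ext_of_mulVec_single
    intro i
    have := hEQ _ (hAV _ (hEV (Pi.single i 1)))
    simp only [Matrix.mulVec_mulVec, Matrix.mul_assoc] at this
    exact this
  have hBE : E * (Q * K.2.1) = K.2.1 := by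
    ext i j
    have := congrFun (hEQ _ hbV) i
    rw [Matrix.mulVec_mulVec] at this
    rw [← Matrix.mul_assoc, Subsingleton.elim j 0]
    simpa [Matrix.mulVec, dotProduct, hb, Matrix.mul_apply] using this
  have hred : ((Q * (K.1 * E), Q * K.2.1, K.2.2 * E) : Ctl m 1 r) ∈ Cset A B C r := by
    refine stable_of_intertwine (fromBlocks 1 0 0 E) (fromBlocks 1 0 0 Q) ?_ ?_ hK
    · simp [fromBlocks_multiply, hQE]
    · simp only [fromBlocks_multiply, Matrix.one_mul, Matrix.mul_one, Matrix.zero_mul,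
        Matrix.mul_zero, add_zero, zero_add, hAE, Matrix.mul_assoc]
      rw [← Matrix.mul_assoc Q K.2.1 C, ← Matrix.mul_assoc E, hBE]
  exact Cset_nonempty_mono (by omega) ⟨_, hred⟩

lemma reduced_of_pathConnected {A : Matrix (Fin n) (Fin n) ℝ} {B : Matrix (Fin n) (Fin m) ℝ}
    {C : Matrix (Fin 1) (Fin n) ℝ} (hn : 1 ≤ n) (h : IsPathConnected (Cset A B C n)) :
    (Cset A B C (n - 1)).Nonempty := by
  obtain ⟨K, hK⟩ := h.nonempty
  have hd : (reflMat (⟨0, hn⟩ : Fin n)).det ≠ 0 := by rw [det_reflMat]; norm_num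
  have hK2 := act_mem hd hK
  have hdd : (ctrMat (act (reflMat (⟨0, hn⟩ : Fin n)) K)).det = -(ctrMat K).det := by
    rw [ctrMat_act _ hd, Matrix.det_mul, det_reflMat]; ring
  have hc := h.isConnected.isPreconnected
  have hcont : ContinuousOn (fun K : Ctl m 1 n => (ctrMat K).det) (Cset A B C n) :=
    continuous_ctrMat.continuousOn
  have : (0 : ℝ) ∈ (fun K : Ctl m 1 n => (ctrMat K).det) '' (Cset A B C n) := by
    rcases le_total (ctrMat K).det 0 with h0 | h0
    · exact hc.intermediate_value hK hK2 hcont ⟨h0, by simp only [hdd]; linarith⟩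
    · exact hc.intermediate_value hK2 hK hcont ⟨by simp only [hdd]; linarith, h0⟩
  obtain ⟨K', hK', h0⟩ := this
  exact reduction hK' h0

end reduction

section dual
variable {n m p : ℕ}

/-- The dual controller. -/
def dualCtl {q : ℕ} (K : Ctl m p q) : Ctl p m q := (K.1ᵀ, K.2.2ᵀ, K.2.1ᵀ)

lemma dualCtl_mem {A : Matrix (Fin n) (Fin n) ℝ} {B : Matrix (Fin n) (Fin m) ℝ}
    {C : Matrix (Fin p) (Fin n) ℝ} {q : ℕ} {K : Ctl m p q} (hK : K ∈ Cset A B C q) :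
    dualCtl K ∈ Cset Aᵀ Cᵀ Bᵀ q := by
  have h := stable_transpose hK
  change IsStableMatrix _
  simpa [fromBlocks_transpose, dualCtl, Matrix.transpose_mul] using h

lemma dual_pathConnected {A : Matrix (Fin n) (Fin n) ℝ} {B : Matrix (Fin n) (Fin m) ℝ}
    {C : Matrix (Fin p) (Fin n) ℝ} {q : ℕ} (h : IsPathConnected (Cset A B C q)) :
    IsPathConnected (Cset Aᵀ Cᵀ Bᵀ q) := by
  have hc : Continuous (dualCtl : Ctl m p q → Ctl p m q) := by
    unfold dualCtl
    exact continuous_fst.matrix_transpose.prodMk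
      (continuous_snd.snd.matrix_transpose.prodMk continuous_snd.fst.matrix_transpose)
  have : dualCtl '' (Cset A B C q) = Cset Aᵀ Cᵀ Bᵀ q := by
    ext K
    constructor
    · rintro ⟨K, hK, rfl⟩
      exact dualCtl_mem hK
    · intro hK
      exact ⟨dualCtl K, by simpa using dualCtl_mem hK, by simp [dualCtl]⟩
  rw [← this]
  exact h.image hc

end dual

/-- Assume `(A, B)` controllable, `(C, A)` observable, and the plant is
single-input or single-output (`m = 1` or `p = 1`). Then `𝒞_n` is path-connected if and
only if there exists a stabilizing controller of order `n − 1`, i.e. `𝒞_{n−1} ≠ ∅`. -/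
theorem Cn_pathConnected_iff_reduced_order_siso (n m p : ℕ)
    (hn : 1 ≤ n) (hm : 0 < m) (hp : 0 < p) (hsiso : m = 1 ∨ p = 1)
    (A : Matrix (Fin n) (Fin n) ℝ) (B : Matrix (Fin n) (Fin m) ℝ)
    (C : Matrix (Fin p) (Fin n) ℝ)
    (hctrb : Controllable A B) (hobs : Controllable Aᵀ Cᵀ) :
    IsPathConnected (Cset A B C n) ↔ (Cset A B C (n - 1)).Nonempty := by
  constructor
  · intro h
    rcases hsiso with rfl | rfl
    · obtain ⟨K, hK⟩ := reduced_of_pathConnected hn (dual_pathConnected h)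
      exact ⟨dualCtl K, by simpa using dualCtl_mem hK⟩
    · exact reduced_of_pathConnected hn h
  · exact pathConnected_of_reduced hn
end
end
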